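/- arXiv:2402.00545 — 3 statements merged into one kernel-verified Lean document; each statement's English description precedes it below -/
import Mathlib

section
/- Let Λ ⊆ Λ' be A-lattices of rank r in L with K·Λ = K·Λ', and let n ∈ A be a monic irreducible polynomial of degree d such that the (n)-torsion of Λ'/Λ is trivial. Fix i with 0 < i < r, let ℒ(Λ,(n),i) be the set of A-submodules Z with nΛ ⊆ Z ⊆ Λ and dim_{A/(n)}(Z/nΛ) = i, let c := #ℒ(Λ,(n),i) (the number of i-dimensional subspaces of an r-dimensional vector space over the field A/(n) with q^d elements), and for Z ∈ ℒ(Λ,(n),i) put Z' := Z + nΛ'. Then ∏_{Z ∈ ℒ(Λ,(n),i)} Δ^{Z'|Z} = n^{e'}·(Δ^{Λ'|Λ})^c, where e' := (1 − [Λ':Λ])·c·q^{di}·(q^{d(r−i)} − 1)/(q^{dr} − 1) is an integer and [Λ':Λ] := #(Λ'/Λ). -/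
open scoped Classical

noncomputable section

variable {Fq : Type*} [Field Fq] [Fintype Fq]
variable {L : Type*} [NormedField L] [CompleteSpace L]
variable [Algebra (Polynomial Fq) L]

/-- `log_q |z|`. -/
def logq (q : ℕ) (z : L) : ℝ := Real.logb q ‖z‖

/-- An `A = 𝔽_q[T]`-lattice of rank `r` in `L`: a finitely generated `A`-submodule which is
free of rank `r` (equivalently: its `𝔽_q(T)`-span has dimension `r`), and which is
discrete in `L` (finite intersection with every bounded ball). -/
def IsLatticeOfRank (r : ℕ) (Λ : Submodule (Polynomial Fq) L) : Prop :=
  (∃ b : Fin r → L, LinearIndependent (Polynomial Fq) b ∧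
      Submodule.span (Polynomial Fq) (Set.range b) = Λ) ∧
  ∀ B : ℝ, {x : L | x ∈ Λ ∧ ‖x‖ ≤ B}.Finite

/-- Membership in `K·Λ`, the `K = 𝔽_q(T)`-span of `Λ` in `L`. -/
def InKSpan (Λ : Submodule (Polynomial Fq) L) (u : L) : Prop :=
  ∃ n : Polynomial Fq, n ≠ 0 ∧ n • u ∈ Λ

/-- The exponential function of the lattice `Λ`: `e^Λ(z) = z·∏_{0≠λ∈Λ} (1 - z/λ)`. -/
def latExp (Λ : Submodule (Polynomial Fq) L) (z : L) : L :=
  z * ∏' l : {x : L // x ∈ Λ ∧ x ≠ 0}, (1 - z / (l : L))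

/-- `R` is a complete set of representatives for the classes of `Λ'` modulo `Λ`. -/
def IsRepSet (Λ Λ' : Submodule (Polynomial Fq) L) (R : Finset L) : Prop :=
  (∀ w ∈ R, w ∈ Λ') ∧ ∀ y ∈ Λ', ∃! w, w ∈ R ∧ y - w ∈ Λ

/-- The discriminant `Δ^{Λ'|Λ} := (∏_{0 ≠ w ∈ Λ'/Λ} e^Λ(w))⁻¹`, computed via a choice of a
complete set of representatives containing `0` (the value is independent of this choice). -/
def latDisc (Λ Λ' : Submodule (Polynomial Fq) L) : L :=
  if h : ∃ R : Finset L, IsRepSet Λ Λ' R ∧ (0 : L) ∈ R then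
    (∏ w ∈ h.choose.erase 0, latExp Λ w)⁻¹
  else 1

/-- The scaled lattice `c·Λ`. -/
def scaleSub (c : L) (Λ : Submodule (Polynomial Fq) L) : Submodule (Polynomial Fq) L :=
  Submodule.map (LinearMap.mulLeft (Polynomial Fq) c) Λ

/-- `ℒ(Λ,(n),i)`: the `A`-submodules `Z` with `nΛ ⊆ Z ⊆ Λ` such that `Z/nΛ` is an
`i`-dimensional vector space over `A/(n)` (a field with `qd = q^{deg n}` elements;
the dimension condition is expressed via the cardinality `qd^i`). -/
def lsetP (n : Polynomial Fq) (Λ : Submodule (Polynomial Fq) L) (i qd : ℕ) :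
    Set (Submodule (Polynomial Fq) L) :=
  {Z | scaleSub (algebraMap (Polynomial Fq) L n) Λ ≤ Z ∧ Z ≤ Λ ∧
    Nat.card (Z ⧸ Submodule.comap Z.subtype
      (scaleSub (algebraMap (Polynomial Fq) L n) Λ)) = qd ^ i}

/-- The elements of norm at most `B` of a discrete lattice. -/
def latBall {Λ : Submodule (Polynomial Fq) L}
    (hD : ∀ B : ℝ, {x : L | x ∈ Λ ∧ ‖x‖ ≤ B}.Finite) (B : ℝ) : Finset L :=
  (hD B).toFinset

/-- The partial product of `latExp` over the lattice elements of norm at most `B`. -/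
def latExpTrunc {Λ : Submodule (Polynomial Fq) L}
    (hD : ∀ B : ℝ, {x : L | x ∈ Λ ∧ ‖x‖ ≤ B}.Finite) (B : ℝ) (z : L) : L :=
  z * ∏ l ∈ (latBall hD B).erase 0, (1 - z / l)

section Exponential

variable {Λ : Submodule (Polynomial Fq) L}
  (hD : ∀ B : ℝ, {x : L | x ∈ Λ ∧ ‖x‖ ≤ B}.Finite)

lemma mem_latBall {B : ℝ} {x : L} : x ∈ latBall hD B ↔ x ∈ Λ ∧ ‖x‖ ≤ B := by
  simp [latBall]

lemma zero_mem_latBall {B : ℝ} (hB : 0 ≤ B) : (0 : L) ∈ latBall hD B := by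
  simp [mem_latBall, hB]

lemma multipliable_latExp
    (hD : ∀ B : ℝ, {x : L | x ∈ Λ ∧ ‖x‖ ≤ B}.Finite) [IsUltrametricDist L] (z : L) :
    Multipliable fun l : {x : L // x ∈ Λ ∧ x ≠ 0} ↦ (1 - z / (l : L)) := by
  have key : Summable fun s : Finset {x : L // x ∈ Λ ∧ x ≠ 0} ↦
      ∏ l ∈ s, (-(z / (l : L))) := by
    apply NonarchimedeanAddGroup.summable_of_tendsto_cofinite_zero
    have hfin : ∀ ε : ℝ, 0 < ε →
        {l : {x : L // x ∈ Λ ∧ x ≠ 0} | ε ≤ ‖z / (l : L)‖}.Finite := by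
      intro ε hε
      refine Set.Finite.of_finite_image (f := Subtype.val) ((hD (‖z‖ / ε)).subset ?_)
        Subtype.val_injective.injOn
      rintro _ ⟨l, hl, rfl⟩
      refine ⟨l.2.1, ?_⟩
      have h0 : 0 < ‖(l : L)‖ := norm_pos_iff.2 l.2.2
      rw [Set.mem_ofPred_eq, norm_div, le_div_iff₀ h0] at hl
      rw [le_div_iff₀ hε]
      linarith
    set S := (hfin 1 one_pos).toFinset with hS
    set C := ∏ l ∈ S, ‖z / (l : L)‖ with hC
    have hCpos : 0 < C := Finset.prod_pos fun l hl ↦ by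
      have : 1 ≤ ‖z / (l : L)‖ := by simpa [S] using hl
      linarith
    have hbound : ∀ s : Finset {x : L // x ∈ Λ ∧ x ≠ 0}, ∏ l ∈ s, ‖z / (l : L)‖ ≤ C := by
      intro s
      calc ∏ l ∈ s, ‖z / (l : L)‖ ≤ ∏ l ∈ s with l ∈ S, ‖z / (l : L)‖ := by
            rw [← Finset.prod_filter_mul_prod_filter_not s (· ∈ S)]
            refine mul_le_of_le_one_right (Finset.prod_nonneg fun _ _ ↦ norm_nonneg _) ?_
            refine Finset.prod_le_one (fun _ _ ↦ norm_nonneg _) fun l hl ↦ ?_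
            have := (Finset.mem_filter.1 hl).2
            simp only [S, Set.Finite.mem_toFinset, Set.mem_ofPred_eq, not_le] at this
            exact this.le
        _ ≤ C := by
            refine Finset.prod_le_prod_of_subset_of_one_le (fun l hl ↦ (Finset.mem_filter.1 hl).2)
              (fun _ _ ↦ norm_nonneg _) fun l hl _ ↦ ?_
            simpa [S] using hl
    rw [Metric.tendsto_nhds]
    intro ε hε
    have hε' : 0 < min (ε / C) 1 := lt_min (div_pos hε hCpos) one_pos
    rw [Filter.eventually_cofinite]
    refine ((hfin _ hε').toFinset.powerset.finite_toSet).subset ?_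
    intro s hs
    simp only [Finset.coe_powerset, Set.mem_preimage, Set.mem_powerset_iff]
    intro l hl
    by_contra hlε
    apply hs
    simp only [Set.Finite.coe_toFinset, Set.mem_ofPred_eq, not_le, lt_min_iff] at hlε
    rw [dist_zero_right, norm_prod]
    simp only [norm_neg]
    rw [← Finset.mul_prod_erase s _ hl]
    calc ‖z / (l : L)‖ * ∏ x ∈ s.erase l, ‖z / (x : L)‖ ≤ ‖z / (l : L)‖ * C :=
          mul_le_mul_of_nonneg_left (hbound _) (norm_nonneg _)
      _ < ε := by rw [← lt_div_iff₀ hCpos]; exact hlε.1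
  simpa [sub_eq_add_neg] using multipliable_one_add_of_summable_prod key

lemma tendsto_latExpTrunc [IsUltrametricDist L] (z : L) :
    Filter.Tendsto (fun k : ℕ ↦ latExpTrunc hD k z) Filter.atTop (nhds (latExp Λ z)) := by
  refine Filter.Tendsto.const_mul z ?_
  have h := (multipliable_latExp hD z).hasProd
  have hmono : Filter.Tendsto (fun k : ℕ ↦ (latBall hD k).subtype fun x ↦ x ∈ Λ ∧ x ≠ 0)
      Filter.atTop Filter.atTop := by
    apply Filter.tendsto_atTop_finset_of_monotone
    · intro a b hab x hx
      simp only [Finset.mem_subtype, mem_latBall] at hx ⊢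
      exact ⟨hx.1, hx.2.trans (by exact_mod_cast hab)⟩
    · intro x
      obtain ⟨k, hk⟩ := exists_nat_ge ‖(x : L)‖
      exact ⟨k, by simp only [Finset.mem_subtype, mem_latBall]; exact ⟨x.2.1, hk⟩⟩
  have h' : Filter.Tendsto (fun s : Finset {x : L // x ∈ Λ ∧ x ≠ 0} ↦
      ∏ l ∈ s, (1 - z / (l : L))) Filter.atTop
      (nhds (∏' l : {x : L // x ∈ Λ ∧ x ≠ 0}, (1 - z / (l : L)))) := by
    simpa [HasProd] using h
  refine (h'.comp hmono).congr fun k ↦ ?_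
  simp only [Function.comp_apply]
  rw [Finset.prod_subtype_eq_prod_filter (f := fun l : L ↦ 1 - z / l)]
  refine Finset.prod_congr ?_ fun _ _ ↦ rfl
  ext x
  simp only [Finset.mem_filter, mem_latBall, Finset.mem_erase]
  tauto

lemma norm_latExpTrunc_eq [IsUltrametricDist L] {z : L} {B B' : ℝ} (hB : ‖z‖ < B)
    (hBB' : B ≤ B') : ‖latExpTrunc hD B' z‖ = ‖latExpTrunc hD B z‖ := by
  have hsub : (latBall hD B).erase 0 ⊆ (latBall hD B').erase 0 := by
    intro x hx
    simp only [Finset.mem_erase, mem_latBall] at hx ⊢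
    exact ⟨hx.1, hx.2.1, hx.2.2.trans hBB'⟩
  rw [latExpTrunc, latExpTrunc, norm_mul, norm_mul, norm_prod, norm_prod,
    ← Finset.prod_sdiff hsub, Finset.prod_eq_one (s := _ \ _), one_mul]
  intro x hx
  simp only [Finset.mem_sdiff, Finset.mem_erase, mem_latBall, not_and, not_le] at hx
  have h1 : B < ‖x‖ := hx.2 hx.1.1 hx.1.2.1
  have h2 : ‖z / x‖ < 1 := by
    rw [norm_div, div_lt_one (norm_pos_iff.2 hx.1.1)]
    linarith
  have := IsUltrametricDist.norm_add_eq_max_of_norm_ne_norm (x := (1 : L)) (y := -(z / x))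
    (by rw [norm_one, norm_neg]; exact h2.ne')
  rw [sub_eq_add_neg, this, norm_one, norm_neg, max_eq_left h2.le]

lemma latExp_ne_zero
    (hD : ∀ B : ℝ, {x : L | x ∈ Λ ∧ ‖x‖ ≤ B}.Finite) [IsUltrametricDist L] {z : L} (hz : z ∉ Λ) : latExp Λ z ≠ 0 := by
  have hz0 : z ≠ 0 := fun h ↦ hz (h ▸ Λ.zero_mem)
  obtain ⟨K, hK⟩ := exists_nat_gt ‖z‖
  have hlim : Filter.Tendsto (fun k : ℕ ↦ ‖latExpTrunc hD k z‖) Filter.atTop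
      (nhds ‖latExpTrunc hD K z‖) := by
    refine tendsto_const_nhds.congr' ?_
    filter_upwards [Filter.eventually_ge_atTop K] with k hk
    exact (norm_latExpTrunc_eq hD hK (by exact_mod_cast hk)).symm
  have := tendsto_nhds_unique (tendsto_latExpTrunc hD z).norm hlim
  rw [← norm_ne_zero_iff, this, norm_ne_zero_iff, latExpTrunc]
  refine mul_ne_zero hz0 (Finset.prod_ne_zero_iff.2 fun x hx h ↦ hz ?_)
  simp only [Finset.mem_erase, mem_latBall] at hx
  rw [sub_eq_zero, eq_div_iff hx.1, one_mul] at h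
  exact h ▸ hx.2.1

lemma latExpTrunc_eq {B : ℝ} (hB : 0 ≤ B) (z : L) :
    latExpTrunc hD B z =
      (∏ l ∈ latBall hD B, (z + l)) / ∏ l ∈ (latBall hD B).erase 0, l := by
  have hneg : ∏ l ∈ (latBall hD B).erase 0, (1 - z / l) =
      ∏ l ∈ (latBall hD B).erase 0, (1 + z / l) := by
    refine Finset.prod_nbij' Neg.neg Neg.neg ?_ ?_ ?_ ?_ ?_ <;>
      simp +contextual [mem_latBall, div_neg, sub_eq_add_neg]
  rw [latExpTrunc, hneg, ← Finset.mul_prod_erase _ _ (zero_mem_latBall hD hB), add_zero,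
    mul_div_assoc, ← Finset.prod_div_distrib]
  congr 1
  refine Finset.prod_congr rfl fun l hl ↦ ?_
  rw [add_div, div_self (Finset.ne_of_mem_erase hl), add_comm]

lemma prod_erase_latBall_ne_zero {B : ℝ} : ∏ l ∈ (latBall hD B).erase 0, l ≠ 0 :=
  Finset.prod_ne_zero_iff.2 fun _ hl ↦ Finset.ne_of_mem_erase hl

lemma latExp_add
    (hD : ∀ B : ℝ, {x : L | x ∈ Λ ∧ ‖x‖ ≤ B}.Finite) [IsUltrametricDist L] (z : L) {l : L} (hl : l ∈ Λ) :
    latExp Λ (z + l) = latExp Λ z := by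
  refine tendsto_nhds_unique (tendsto_latExpTrunc hD (z + l))
    ((tendsto_latExpTrunc hD z).congr' ?_)
  obtain ⟨K, hK⟩ := exists_nat_ge ‖l‖
  filter_upwards [Filter.eventually_ge_atTop K] with k hk
  have hlk : ‖l‖ ≤ k := hK.trans (by exact_mod_cast hk)
  rw [latExpTrunc_eq hD k.cast_nonneg, latExpTrunc_eq hD k.cast_nonneg]
  congr 1
  symm
  refine Finset.prod_nbij' (fun x ↦ l + x) (fun x ↦ x - l) ?_ ?_ ?_ ?_ ?_
  · intro x hx
    rw [mem_latBall] at hx ⊢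
    exact ⟨Λ.add_mem hl hx.1, (IsUltrametricDist.norm_add_le_max _ _).trans (max_le hlk hx.2)⟩
  · intro x hx
    rw [mem_latBall] at hx ⊢
    refine ⟨Λ.sub_mem hx.1 hl, ?_⟩
    rw [sub_eq_add_neg]
    exact (IsUltrametricDist.norm_add_le_max _ _).trans (max_le hx.2 (by rwa [norm_neg]))
  · simp
  · simp
  · intro x _
    ring

lemma prod_latBall_eq [IsUltrametricDist L] {Z : Submodule (Polynomial Fq) L}
    (hDZ : ∀ B : ℝ, {x : L | x ∈ Z ∧ ‖x‖ ≤ B}.Finite) (hle : Λ ≤ Z) {R : Finset L}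
    (hR : IsRepSet Λ Z R) {B : ℝ} (hB : ∀ u ∈ R, ‖u‖ ≤ B) (g : L → L) :
    ∏ x ∈ latBall hDZ B, g x = ∏ u ∈ R, ∏ l ∈ latBall hD B, g (u + l) := by
  rw [← Finset.prod_product']
  symm
  refine Finset.prod_bij (fun p _ ↦ p.1 + p.2) ?_ ?_ ?_ fun _ _ ↦ rfl
  · rintro ⟨u, l⟩ h
    simp only [Finset.mem_product, mem_latBall] at h ⊢
    exact ⟨Z.add_mem (hR.1 u h.1) (hle h.2.1),
      (IsUltrametricDist.norm_add_le_max _ _).trans (max_le (hB u h.1) h.2.2)⟩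
  · rintro ⟨u, l⟩ h ⟨u', l'⟩ h' heq
    simp only [Finset.mem_product, mem_latBall] at h h' heq
    have : u = u' := by
      refine (hR.2 (u + l) (Z.add_mem (hR.1 u h.1) (hle h.2.1))).unique ⟨h.1, ?_⟩ ⟨h'.1, ?_⟩
      · simpa using h.2.1
      · simpa [heq] using h'.2.1
    subst this
    simpa using heq
  · intro x hx
    rw [mem_latBall] at hx
    obtain ⟨u, ⟨hu, hxu⟩, -⟩ := hR.2 x hx.1
    refine ⟨(u, x - u), ?_, by simp⟩
    simp only [Finset.mem_product, mem_latBall]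
    refine ⟨hu, hxu, ?_⟩
    rw [sub_eq_add_neg]
    exact (IsUltrametricDist.norm_add_le_max _ _).trans
      (max_le hx.2 (by rw [norm_neg]; exact hB u hu))

lemma latExpTrunc_of_le [IsUltrametricDist L] {Z : Submodule (Polynomial Fq) L}
    (hDZ : ∀ B : ℝ, {x : L | x ∈ Z ∧ ‖x‖ ≤ B}.Finite) (hle : Λ ≤ Z) {R : Finset L}
    (hR : IsRepSet Λ Z R) (h0 : (0 : L) ∈ R) {B : ℝ} (hB : ∀ u ∈ R, ‖u‖ ≤ B) (z : L) :
    latExpTrunc hDZ B z =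
      latExpTrunc hD B z *
        ∏ u ∈ R.erase 0, latExpTrunc hD B (u - z) / latExpTrunc hD B u := by
  have hB0 : 0 ≤ B := (norm_nonneg _).trans (hB 0 h0)
  have herase : ∀ {M : Submodule (Polynomial Fq) L}
      (hM : ∀ B : ℝ, {x : L | x ∈ M ∧ ‖x‖ ≤ B}.Finite),
      ∏ l ∈ (latBall hM B).erase 0, (1 - z / l) =
        ∏ l ∈ latBall hM B, if l = 0 then 1 else (1 - z / l) := by
    intro M hM
    rw [← Finset.mul_prod_erase _ _ (zero_mem_latBall hM hB0), if_pos rfl, one_mul]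
    exact Finset.prod_congr rfl fun l hl ↦ (if_neg (Finset.ne_of_mem_erase hl)).symm
  rw [latExpTrunc, latExpTrunc, herase hDZ, herase hD, prod_latBall_eq hD hDZ hle hR hB,
    ← Finset.mul_prod_erase _ _ h0, mul_assoc]
  simp only [zero_add]
  congr 2
  refine Finset.prod_congr rfl fun u hu ↦ ?_
  rw [latExpTrunc_eq hD hB0, latExpTrunc_eq hD hB0,
    div_div_div_cancel_right₀ (prod_erase_latBall_ne_zero hD), ← Finset.prod_div_distrib]
  refine Finset.prod_congr rfl fun l hl ↦ ?_
  have hul : u + l ≠ 0 := by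
    intro h
    have hl' := ((mem_latBall hD).1 hl).1
    refine Finset.ne_of_mem_erase hu ((hR.2 0 Z.zero_mem).unique
      ⟨Finset.mem_of_mem_erase hu, ?_⟩ ⟨h0, by simp⟩)
    rwa [zero_sub, ← eq_neg_of_add_eq_zero_right h]
  rw [if_neg hul]
  field_simp
  ring

lemma IsRepSet.notMem {Z : Submodule (Polynomial Fq) L} {R : Finset L}
    (hR : IsRepSet Λ Z R) (h0 : (0 : L) ∈ R) {u : L} (hu : u ∈ R.erase 0) : u ∉ Λ := by
  intro h
  refine Finset.ne_of_mem_erase hu ((hR.2 u (hR.1 u (Finset.mem_of_mem_erase hu))).unique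
    ⟨Finset.mem_of_mem_erase hu, by simp⟩ ⟨h0, by simpa⟩)

lemma latExp_of_le
    (hD : ∀ B : ℝ, {x : L | x ∈ Λ ∧ ‖x‖ ≤ B}.Finite) [IsUltrametricDist L] {Z : Submodule (Polynomial Fq) L}
    (hDZ : ∀ B : ℝ, {x : L | x ∈ Z ∧ ‖x‖ ≤ B}.Finite) (hle : Λ ≤ Z) {R : Finset L}
    (hR : IsRepSet Λ Z R) (h0 : (0 : L) ∈ R) (z : L) :
    latExp Z z = latExp Λ z * ∏ u ∈ R.erase 0, latExp Λ (u - z) / latExp Λ u := by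
  refine tendsto_nhds_unique (tendsto_latExpTrunc hDZ z) (Filter.Tendsto.congr' ?_
    ((tendsto_latExpTrunc hD z).mul (tendsto_finsetProd (R.erase 0) fun u hu ↦
      (tendsto_latExpTrunc hD (u - z)).div (tendsto_latExpTrunc hD u)
        (latExp_ne_zero hD (hR.notMem h0 hu)))))
  obtain ⟨K, hK⟩ := exists_nat_ge (∑ u ∈ R, ‖u‖)
  filter_upwards [Filter.eventually_ge_atTop K] with k hk
  refine (latExpTrunc_of_le hD hDZ hle hR h0 (fun u hu ↦ ?_) z).symm
  exact (Finset.single_le_sum (f := fun u : L ↦ ‖u‖) (fun _ _ ↦ norm_nonneg _) hu).trans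
    (hK.trans (by exact_mod_cast hk))

end Exponential

lemma latExp_scaleSub {c : L} (hc : c ≠ 0) (Λ : Submodule (Polynomial Fq) L) (z : L) :
    latExp (scaleSub c Λ) (c * z) = c * latExp Λ z := by
  let e : {x : L // x ∈ Λ ∧ x ≠ 0} ≃ {x : L // x ∈ scaleSub c Λ ∧ x ≠ 0} :=
    (Equiv.mulLeft₀ c hc).subtypeEquiv fun x ↦ by simp [scaleSub, hc]
  rw [latExp, latExp, mul_assoc, ← e.tprod_eq]
  congr 3
  funext l
  change 1 - c * z / (c * l) = _
  rw [mul_div_mul_left _ _ hc]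

section Representatives

variable {Λ Λ' : Submodule (Polynomial Fq) L}

lemma quotient_comap_mk_eq_iff {x y : Λ'} :
    (Submodule.Quotient.mk x : Λ' ⧸ Λ.comap Λ'.subtype) = Submodule.Quotient.mk y ↔
      (x : L) - y ∈ Λ :=
  Submodule.Quotient.eq _

lemma IsRepSet.existsUnique_quotient {R : Finset L} (hR : IsRepSet Λ Λ' R) (y : Λ') :
    ∃! w : R, (Submodule.Quotient.mk ⟨w, hR.1 w w.2⟩ : Λ' ⧸ Λ.comap Λ'.subtype) =
      Submodule.Quotient.mk y := by
  obtain ⟨w, ⟨hw, hyw⟩, huniq⟩ := hR.2 y y.2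
  refine ⟨⟨w, hw⟩, ?_, fun v hv ↦ Subtype.ext (huniq v ⟨v.2, ?_⟩)⟩
  · exact (quotient_comap_mk_eq_iff.2 hyw).symm
  · exact quotient_comap_mk_eq_iff.1 hv.symm

lemma IsRepSet.card_eq {R : Finset L} (hR : IsRepSet Λ Λ' R) :
    R.card = Nat.card (Λ' ⧸ Λ.comap Λ'.subtype) := by
  rw [← Nat.card_eq_finsetCard]
  refine Nat.card_congr (Equiv.ofBijective
    (fun w : R ↦ (Submodule.Quotient.mk ⟨w, hR.1 w w.2⟩ : Λ' ⧸ Λ.comap Λ'.subtype)) ?_)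
  refine (Function.bijective_iff_existsUnique _).2 fun x ↦ ?_
  obtain ⟨y, rfl⟩ := Submodule.Quotient.mk_surjective _ x
  exact hR.existsUnique_quotient y

lemma exists_isRepSet [Finite (Λ' ⧸ Λ.comap Λ'.subtype)] :
    ∃ R : Finset L, IsRepSet Λ Λ' R ∧ (0 : L) ∈ R := by
  have := Fintype.ofFinite (Λ' ⧸ Λ.comap Λ'.subtype)
  let s : (Λ' ⧸ Λ.comap Λ'.subtype) → Λ' := fun x ↦ if x = 0 then 0 else x.out
  have hs : ∀ x, Submodule.Quotient.mk (s x) = x := by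
    intro x
    by_cases hx : x = 0
    · simp [s, hx]
    · simp only [s, if_neg hx]
      exact Quotient.out_eq x
  refine ⟨Finset.univ.image fun x ↦ (s x : L), ⟨?_, ?_⟩, ?_⟩
  · intro w hw
    obtain ⟨x, -, rfl⟩ := Finset.mem_image.1 hw
    exact (s x).2
  · intro y hy
    refine ⟨s (Submodule.Quotient.mk ⟨y, hy⟩), ⟨Finset.mem_image_of_mem _ (Finset.mem_univ _), ?_⟩,
      ?_⟩
    · exact quotient_comap_mk_eq_iff.1 (hs (Submodule.Quotient.mk ⟨y, hy⟩)).symm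
    · rintro w ⟨hw, hyw⟩
      obtain ⟨x, -, rfl⟩ := Finset.mem_image.1 hw
      have : (Submodule.Quotient.mk ⟨y, hy⟩ : Λ' ⧸ Λ.comap Λ'.subtype) = x := by
        conv_rhs => rw [← hs x]
        exact quotient_comap_mk_eq_iff.2 hyw
      rw [this]
  · exact Finset.mem_image.2 ⟨0, Finset.mem_univ _, by simp [s]⟩

lemma IsRepSet.prod_erase_eq {R S : Finset L} (hR : IsRepSet Λ Λ' R) (hS : IsRepSet Λ Λ' S)
    (hR0 : (0 : L) ∈ R) (hS0 : (0 : L) ∈ S) {g : L → L}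
    (hg : ∀ z, ∀ l ∈ Λ, g (z + l) = g z) :
    ∏ w ∈ R.erase 0, g w = ∏ w ∈ S.erase 0, g w := by
  choose! t ht ht' using fun y hy ↦ (hS.2 y hy).exists
  have hinj : ∀ a ∈ R, ∀ b ∈ R, t a = t b → a = b := by
    intro a ha b hb hab
    refine (hR.2 a (hR.1 a ha)).unique ⟨ha, by simp⟩ ⟨hb, ?_⟩
    have := Λ.sub_mem (ht' a (hR.1 a ha)) (ht' b (hR.1 b hb))
    rw [hab] at this
    simpa using this
  have ht0 : t 0 = 0 :=
    (hS.2 0 Λ'.zero_mem).unique ⟨ht 0 Λ'.zero_mem, ht' 0 Λ'.zero_mem⟩ ⟨hS0, by simp⟩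
  refine Finset.prod_bij (fun a _ ↦ t a) ?_ ?_ ?_ ?_
  · intro a ha
    have haR := Finset.mem_of_mem_erase ha
    refine Finset.mem_erase.2 ⟨fun h ↦ Finset.ne_of_mem_erase ha ?_, ht a (hR.1 a haR)⟩
    exact hinj a haR 0 hR0 (h.trans ht0.symm)
  · intro a ha b hb
    exact hinj a (Finset.mem_of_mem_erase ha) b (Finset.mem_of_mem_erase hb)
  · intro b hb
    have hbS := Finset.mem_of_mem_erase hb
    obtain ⟨a, ⟨haR, hab⟩, -⟩ := hR.2 b (hS.1 b hbS)
    have hta : t a = b := by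
      refine (hS.2 a (hR.1 a haR)).unique ⟨ht a (hR.1 a haR), ht' a (hR.1 a haR)⟩ ⟨hbS, ?_⟩
      rw [← neg_sub]
      exact Λ.neg_mem hab
    refine ⟨a, Finset.mem_erase.2 ⟨?_, haR⟩, hta⟩
    rintro rfl
    exact Finset.ne_of_mem_erase hb (hta.symm.trans ht0)
  · intro a ha
    have := hg (t a) _ (ht' a (hR.1 a (Finset.mem_of_mem_erase ha)))
    rw [← this]
    congr 1
    ring

lemma latDisc_eq [IsUltrametricDist L]
    (hD : ∀ B : ℝ, {x : L | x ∈ Λ ∧ ‖x‖ ≤ B}.Finite) {R : Finset L}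
    (hR : IsRepSet Λ Λ' R) (hR0 : (0 : L) ∈ R) :
    latDisc Λ Λ' = (∏ w ∈ R.erase 0, latExp Λ w)⁻¹ := by
  have h : ∃ R : Finset L, IsRepSet Λ Λ' R ∧ (0 : L) ∈ R := ⟨R, hR, hR0⟩
  rw [latDisc, dif_pos h,
    h.choose_spec.1.prod_erase_eq hR h.choose_spec.2 hR0 fun z l hl ↦ latExp_add hD z hl]

lemma mem_scaleSub {c x : L} : x ∈ scaleSub c Λ ↔ ∃ y ∈ Λ, c * y = x := by
  simp [scaleSub]

lemma scaleSub_algebraMap_le (n : Polynomial Fq) (Λ : Submodule (Polynomial Fq) L) :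
    scaleSub (algebraMap (Polynomial Fq) L n) Λ ≤ Λ := by
  intro x hx
  obtain ⟨y, hy, rfl⟩ := mem_scaleSub.1 hx
  rw [← Algebra.smul_def]
  exact Λ.smul_mem n hy

/-- Multiplication by `n` permutes the classes of `Λ'` modulo `Λ` when `Λ' / Λ` is finite
without `n`-torsion. -/
lemma IsRepSet.image_mul {R : Finset L} (hR : IsRepSet Λ Λ' R) {n : Polynomial Fq}
    (htor : ∀ y ∈ Λ', n • y ∈ Λ → y ∈ Λ) :
    IsRepSet Λ Λ' (R.image (algebraMap (Polynomial Fq) L n * ·)) := by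
  simp only [← Algebra.smul_def]
  have hmem : ∀ w ∈ R, n • w ∈ Λ' := fun w hw ↦ Λ'.smul_mem n (hR.1 w hw)
  choose! t ht ht' using fun y hy ↦ (hR.2 y hy).exists
  have hinj : ∀ a ∈ R, ∀ b ∈ R, n • a - n • b ∈ Λ → a = b := by
    intro a ha b hb hab
    refine (hR.2 a (hR.1 a ha)).unique ⟨ha, by simp⟩ ⟨hb, ?_⟩
    exact htor _ (Λ'.sub_mem (hR.1 a ha) (hR.1 b hb)) (by rwa [smul_sub])
  have hsurj : ∀ w ∈ R, ∃ a ∈ R, t (n • a) = w := by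
    have := Finset.surjOn_of_injOn_of_card_le (s := R) (t := R) (fun a ↦ t (n • a))
      (fun a ha ↦ ht _ (hmem a ha)) (fun a ha b hb hab ↦ hinj a ha b hb ?_) le_rfl
    · intro w hw
      exact this hw
    · have h := Λ.sub_mem (ht' _ (hmem a ha)) (ht' _ (hmem b hb))
      simp only at hab
      rw [hab] at h
      simpa using h
  refine ⟨?_, fun y hy ↦ ?_⟩
  · intro w hw
    obtain ⟨a, ha, rfl⟩ := Finset.mem_image.1 hw
    exact hmem a ha
  · obtain ⟨a, ha, hta⟩ := hsurj (t y) (ht y hy)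
    refine ⟨n • a, ⟨Finset.mem_image_of_mem _ ha, ?_⟩, ?_⟩
    · have := Λ.sub_mem (ht' y hy) (ht' _ (hmem a ha))
      rw [hta] at this
      simpa using this
    · rintro w ⟨hw, hyw⟩
      obtain ⟨b, hb, rfl⟩ := Finset.mem_image.1 hw
      rw [hinj b hb a ha]
      have h1 := Λ.sub_mem (ht' y hy) (ht' _ (hmem a ha))
      rw [hta] at h1
      have := Λ.sub_mem h1 hyw
      simpa using this

lemma IsRepSet.image_mul_sup {R : Finset L} (hR : IsRepSet Λ Λ' R) {n : Polynomial Fq}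
    (htor : ∀ y ∈ Λ', n • y ∈ Λ → y ∈ Λ) {Z : Submodule (Polynomial Fq) L}
    (hZ : scaleSub (algebraMap (Polynomial Fq) L n) Λ ≤ Z) (hZΛ : Z ≤ Λ) :
    IsRepSet Z (Z ⊔ scaleSub (algebraMap (Polynomial Fq) L n) Λ')
      (R.image (algebraMap (Polynomial Fq) L n * ·)) := by
  refine ⟨?_, fun y hy ↦ ?_⟩
  · intro w hw
    obtain ⟨a, ha, rfl⟩ := Finset.mem_image.1 hw
    exact Submodule.mem_sup_right (mem_scaleSub.2 ⟨a, hR.1 a ha, rfl⟩)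
  · obtain ⟨z, hz, y', hy', rfl⟩ := Submodule.mem_sup.1 hy
    obtain ⟨x, hx, rfl⟩ := mem_scaleSub.1 hy'
    obtain ⟨a, ⟨ha, hxa⟩, -⟩ := hR.2 x hx
    have hmem : z + algebraMap (Polynomial Fq) L n * x - algebraMap (Polynomial Fq) L n * a ∈ Z := by
      rw [add_sub_assoc, ← mul_sub]
      exact Z.add_mem hz (hZ (mem_scaleSub.2 ⟨_, hxa, rfl⟩))
    refine ⟨_, ⟨Finset.mem_image_of_mem _ ha, hmem⟩, ?_⟩
    rintro w ⟨hw, hyw⟩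
    obtain ⟨b, hb, rfl⟩ := Finset.mem_image.1 hw
    congr 1
    refine (hR.2 b (hR.1 b hb)).unique ⟨hb, by simp⟩ ⟨ha, ?_⟩
    refine htor _ (Λ'.sub_mem (hR.1 b hb) (hR.1 a ha)) (hZΛ ?_)
    have := Z.sub_mem hmem hyw
    rw [Algebra.smul_def, mul_sub]
    simpa using this

lemma IsRepSet.filter_mem {M : Submodule (Polynomial Fq) L} {R : Finset L}
    (hR : IsRepSet M Λ R) {Z : Submodule (Polynomial Fq) L} (hMZ : M ≤ Z) (hZΛ : Z ≤ Λ) :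
    IsRepSet M Z (R.filter (· ∈ Z)) := by
  refine ⟨fun w hw ↦ (Finset.mem_filter.1 hw).2, fun y hy ↦ ?_⟩
  obtain ⟨w, ⟨hw, hyw⟩, huniq⟩ := hR.2 y (hZΛ hy)
  refine ⟨w, ⟨Finset.mem_filter.2 ⟨hw, ?_⟩, hyw⟩, fun v hv ↦
    huniq v ⟨(Finset.mem_filter.1 hv.1).1, hv.2⟩⟩
  have := Z.sub_mem hy (hMZ hyw)
  simpa using this

end Representatives

section Counting

lemma natCard_quotient_span {n : Polynomial Fq} (hn : n ≠ 0) :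
    Nat.card (Polynomial Fq ⧸ Ideal.span {n}) = Fintype.card Fq ^ n.natDegree := by
  have := (AdjoinRoot.powerBasis hn).finite
  have h := Module.natCard_eq_pow_finrank (K := Fq) (V := AdjoinRoot n)
  rw [(AdjoinRoot.powerBasis hn).finrank, AdjoinRoot.powerBasis_dim hn,
    Nat.card_eq_fintype_card (α := Fq)] at h
  exact h

lemma finite_quotient_span {n : Polynomial Fq} (hn : n ≠ 0) :
    Finite (Polynomial Fq ⧸ Ideal.span {n}) := by
  refine Nat.finite_of_card_ne_zero ?_
  rw [natCard_quotient_span hn]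
  exact pow_ne_zero _ Fintype.card_ne_zero

lemma exists_linearEquiv_apply_eq {K V : Type*} [Field K] [AddCommGroup V] [Module K V]
    [FiniteDimensional K V] {v w : V} (hv : v ≠ 0) (hw : w ≠ 0) :
    ∃ s : V ≃ₗ[K] V, s v = w := by
  obtain ⟨s, hs⟩ := Submodule.exists_linearEquiv_restrict_eq
    ((LinearEquiv.toSpanNonzeroSingleton K V v hv).symm ≪≫ₗ
      LinearEquiv.toSpanNonzeroSingleton K V w hw)
  refine ⟨s, ?_⟩
  have h1 : (LinearEquiv.toSpanNonzeroSingleton K V v hv).symm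
      ⟨v, Submodule.mem_span_singleton_self v⟩ = 1 := by
    rw [LinearEquiv.symm_apply_eq]
    ext
    simp
  have := hs ⟨v, Submodule.mem_span_singleton_self v⟩
  rw [LinearEquiv.trans_apply, h1] at this
  simpa using this.symm

lemma finite_quotient_of_inKSpan {r : ℕ} {Λ Λ' : Submodule (Polynomial Fq) L}
    (hΛ' : IsLatticeOfRank r Λ') (h : ∀ u ∈ Λ', InKSpan Λ u) :
    Finite (Λ' ⧸ Λ.comap Λ'.subtype) := by
  obtain ⟨⟨b, -, hspan⟩, -⟩ := hΛ'
  have hb : ∀ j, b j ∈ Λ' := fun j ↦ hspan ▸ Submodule.subset_span (Set.mem_range_self j)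
  choose a ha0 ha using fun j ↦ h (b j) (hb j)
  have hc : ∀ y ∈ Λ', (∏ j, a j) • y ∈ Λ := by
    intro y hy
    rw [← hspan] at hy
    induction hy using Submodule.span_induction with
    | mem x hx =>
      obtain ⟨j, rfl⟩ := hx
      rw [← Finset.prod_erase_mul _ _ (Finset.mem_univ j), mul_smul]
      exact Λ.smul_mem _ (ha j)
    | zero => simp
    | add x y _ _ hx hy => rw [smul_add]; exact Λ.add_mem hx hy
    | smul c x _ hx => rw [smul_comm]; exact Λ.smul_mem _ hx
  set c := ∏ j, a j
  have hc0 : c ≠ 0 := Finset.prod_ne_zero_iff.2 fun j _ ↦ ha0 j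
  have htors : Module.IsTorsionBySet (Polynomial Fq) (Λ' ⧸ Λ.comap Λ'.subtype)
      (Ideal.span {c} : Ideal (Polynomial Fq)) := by
    rw [Module.isTorsionBySet_span_singleton_iff]
    intro x
    obtain ⟨y, rfl⟩ := Submodule.Quotient.mk_surjective _ x
    rw [← Submodule.Quotient.mk_smul, Submodule.Quotient.mk_eq_zero]
    exact hc y y.2
  have hfg : Module.Finite (Polynomial Fq) Λ' :=
    Module.Finite.iff_fg.2 ⟨Finset.univ.image b, by simpa using hspan⟩
  let := htors.module
  have := finite_quotient_span hc0
  have : Module.Finite (Polynomial Fq ⧸ Ideal.span {c}) (Λ' ⧸ Λ.comap Λ'.subtype) :=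
    Module.Finite.of_restrictScalars_finite (Polynomial Fq) _ _
  exact Module.finite_of_finite (Polynomial Fq ⧸ Ideal.span {c})

lemma exists_reduction {r : ℕ} {Λ : Submodule (Polynomial Fq) L} (hΛ : IsLatticeOfRank r Λ)
    (n : Polynomial Fq) :
    ∃ f : Λ →ₗ[Polynomial Fq] (Fin r → Polynomial Fq ⧸ Ideal.span {n}),
      Function.Surjective f ∧
      ∀ x : Λ, f x = 0 ↔ (x : L) ∈ scaleSub (algebraMap (Polynomial Fq) L n) Λ := by
  obtain ⟨⟨b, hli, rfl⟩, -⟩ := hΛ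
  let e := (Module.Basis.span hli).equivFun
  refine ⟨((Algebra.linearMap (Polynomial Fq) (Polynomial Fq ⧸ Ideal.span {n})).compLeft
    (Fin r)) ∘ₗ e.toLinearMap, ?_, fun x ↦ ?_⟩
  · have : Function.Surjective (Algebra.linearMap (Polynomial Fq)
        (Polynomial Fq ⧸ Ideal.span {n})) := Ideal.Quotient.mk_surjective
    exact (this.comp_left).comp e.surjective
  · have h1 : (((Algebra.linearMap (Polynomial Fq) (Polynomial Fq ⧸ Ideal.span {n})).compLeft
        (Fin r)) ∘ₗ e.toLinearMap) x = 0 ↔ ∀ j, n ∣ e x j := by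
      rw [funext_iff]
      refine forall_congr' fun j ↦ ?_
      rw [← Ideal.mem_span_singleton, ← Ideal.Quotient.eq_zero_iff_mem]
      rfl
    rw [h1, mem_scaleSub]
    constructor
    · intro h
      choose g hg using h
      refine ⟨e.symm g, (e.symm g).2, ?_⟩
      rw [← Algebra.smul_def, ← Submodule.coe_smul, ← map_smul]
      congr 1
      rw [LinearEquiv.symm_apply_eq]
      funext j
      simp [hg j]
    · rintro ⟨y, hy, hyx⟩ j
      have : x = n • ⟨y, hy⟩ := Subtype.ext (by rw [← hyx, ← Algebra.smul_def]; rfl)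
      rw [this, map_smul]
      exact Dvd.intro _ rfl

variable {V : Type*} [AddCommGroup V] [Module (Polynomial Fq) V]

/-- The submodules between `M = ker f` and `Λ` correspond to the submodules of the quotient. -/
def submodulesBetweenEquiv {Λ M : Submodule (Polynomial Fq) L} (hM : M ≤ Λ)
    (f : Λ →ₗ[Polynomial Fq] V) (hf : Function.Surjective f)
    (hker : ∀ x : Λ, f x = 0 ↔ (x : L) ∈ M) :
    {Z : Submodule (Polynomial Fq) L // M ≤ Z ∧ Z ≤ Λ} ≃ Submodule (Polynomial Fq) V where
  toFun Z := (Z.1.comap Λ.subtype).map f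
  invFun W := ⟨(W.comap f).map Λ.subtype, fun x hx ↦
    ⟨⟨x, hM hx⟩, by simp [(hker ⟨x, hM hx⟩).2 hx], rfl⟩, Submodule.map_subtype_le _ _⟩
  left_inv := by
    rintro ⟨Z, hMZ, hZΛ⟩
    apply Subtype.ext
    have hle : f.ker ≤ Z.comap Λ.subtype := fun x hx ↦ hMZ ((hker x).1 hx)
    simp only [Submodule.comap_map_eq, sup_eq_left.2 hle, Submodule.map_comap_subtype,
      inf_eq_right.2 hZΛ]
  right_inv W := by
    simp only [Submodule.comap_map_eq, Submodule.ker_subtype, sup_bot_eq,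
      Submodule.map_comap_eq_of_surjective hf]

lemma mem_submodulesBetweenEquiv {Λ M : Submodule (Polynomial Fq) L} (hM : M ≤ Λ)
    (f : Λ →ₗ[Polynomial Fq] V) (hf : Function.Surjective f)
    (hker : ∀ x : Λ, f x = 0 ↔ (x : L) ∈ M)
    (Z : {Z : Submodule (Polynomial Fq) L // M ≤ Z ∧ Z ≤ Λ}) (u : Λ) :
    f u ∈ submodulesBetweenEquiv hM f hf hker Z ↔ (u : L) ∈ Z.1 := by
  refine ⟨?_, fun hu ↦ Submodule.mem_map_of_mem hu⟩
  rintro ⟨x, hx, hxu⟩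
  have : ((u - x : Λ) : L) ∈ M := (hker _).1 (by rw [map_sub, hxu, sub_self])
  have := Z.1.add_mem (Z.2.1 this) hx
  simpa using this

lemma natCard_submodulesBetweenEquiv {Λ M : Submodule (Polynomial Fq) L} (hM : M ≤ Λ)
    (f : Λ →ₗ[Polynomial Fq] V) (hf : Function.Surjective f)
    (hker : ∀ x : Λ, f x = 0 ↔ (x : L) ∈ M)
    (Z : {Z : Submodule (Polynomial Fq) L // M ≤ Z ∧ Z ≤ Λ}) :
    Nat.card (submodulesBetweenEquiv hM f hf hker Z) =
      Nat.card (Z.1 ⧸ M.comap Z.1.subtype) := by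
  let g : Z.1 →ₗ[Polynomial Fq] V := f ∘ₗ Submodule.inclusion Z.2.2
  have hg : g.ker = M.comap Z.1.subtype := by
    ext x
    exact hker _
  have hrange : g.range = submodulesBetweenEquiv hM f hf hker Z := by
    rw [LinearMap.range_comp, Submodule.range_inclusion]
    rfl
  rw [← hg, ← hrange]
  exact (Nat.card_congr g.quotKerEquivRange.toEquiv).symm

/-- The number of `Z ∈ ℒ(Λ,(n),i)` through a point outside `nΛ` does not depend on the point. -/
lemma natCard_lsetP_mem_eq {r : ℕ} {Λ : Submodule (Polynomial Fq) L}
    (hΛ : IsLatticeOfRank r Λ) {n : Polynomial Fq} (hirr : Irreducible n) (i qd : ℕ)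
    {u v : L} (hu : u ∈ Λ) (hv : v ∈ Λ)
    (hu' : u ∉ scaleSub (algebraMap (Polynomial Fq) L n) Λ)
    (hv' : v ∉ scaleSub (algebraMap (Polynomial Fq) L n) Λ) :
    Nat.card {Z // Z ∈ lsetP n Λ i qd ∧ u ∈ Z} = Nat.card {Z // Z ∈ lsetP n Λ i qd ∧ v ∈ Z} := by
  obtain ⟨f, hf, hker⟩ := exists_reduction hΛ n
  have hM := scaleSub_algebraMap_le n Λ
  have := PrincipalIdealRing.isMaximal_of_irreducible hirr
  let := Ideal.Quotient.field (Ideal.span {n})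
  obtain ⟨s, hs⟩ := exists_linearEquiv_apply_eq (K := Polynomial Fq ⧸ Ideal.span {n})
    (v := f ⟨u, hu⟩) (w := f ⟨v, hv⟩) (by rwa [Ne, hker]) (by rwa [Ne, hker])
  let σ : (Fin r → Polynomial Fq ⧸ Ideal.span {n}) ≃ₗ[Polynomial Fq]
    (Fin r → Polynomial Fq ⧸ Ideal.span {n}) := s.restrictScalars (Polynomial Fq)
  have hσ : σ (f ⟨u, hu⟩) = f ⟨v, hv⟩ := hs
  have key : ∀ x : L, ∀ hx : x ∈ Λ,
      Nat.card {Z // Z ∈ lsetP n Λ i qd ∧ x ∈ Z} =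
        Nat.card {W : Submodule (Polynomial Fq) (Fin r → Polynomial Fq ⧸ Ideal.span {n}) //
          Nat.card W = qd ^ i ∧ f ⟨x, hx⟩ ∈ W} := by
    intro x hx
    refine Nat.card_congr (Equiv.trans ?_
      ((submodulesBetweenEquiv hM f hf hker).subtypeEquiv (p := fun Z ↦
        Nat.card (Z.1 ⧸ Submodule.comap Z.1.subtype
          (scaleSub (algebraMap (Polynomial Fq) L n) Λ)) = qd ^ i ∧ x ∈ Z.1) fun Z ↦ ?_))
    · exact
        { toFun := fun Z ↦ ⟨⟨Z.1, Z.2.1.1, Z.2.1.2.1⟩, Z.2.1.2.2, Z.2.2⟩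
          invFun := fun Z ↦ ⟨Z.1.1, ⟨Z.1.2.1, Z.1.2.2, Z.2.1⟩, Z.2.2⟩
          left_inv := fun _ ↦ rfl
          right_inv := fun _ ↦ rfl }
    · rw [natCard_submodulesBetweenEquiv, mem_submodulesBetweenEquiv hM f hf hker Z ⟨x, hx⟩]
  rw [key u hu, key v hv]
  refine Nat.card_congr ((Submodule.orderIsoMapComap σ).toEquiv.subtypeEquiv fun W ↦ ?_)
  refine and_congr ?_ ?_
  · rw [Nat.card_congr (σ.submoduleMap W).toEquiv]
    rfl
  · rw [← hσ]
    refine ⟨fun h ↦ Submodule.mem_map_of_mem h, ?_⟩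
    rintro ⟨y, hy, hyx⟩
    exact σ.injective hyx ▸ hy

lemma finite_lsetP {r : ℕ} {Λ : Submodule (Polynomial Fq) L}
    (hΛ : IsLatticeOfRank r Λ) {n : Polynomial Fq} (hn : n ≠ 0) (i qd : ℕ) :
    (lsetP n Λ i qd).Finite := by
  obtain ⟨f, hf, hker⟩ := exists_reduction hΛ n
  have hM := scaleSub_algebraMap_le n Λ
  have := finite_quotient_span hn
  have := Finite.of_equiv _ (submodulesBetweenEquiv hM f hf hker).symm
  have hfin : {Z : Submodule (Polynomial Fq) L |
      scaleSub (algebraMap (Polynomial Fq) L n) Λ ≤ Z ∧ Z ≤ Λ}.Finite := this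
  exact hfin.subset fun Z hZ ↦ ⟨hZ.1, hZ.2.1⟩

lemma natCard_quotient_scaleSub {r : ℕ} {Λ : Submodule (Polynomial Fq) L}
    (hΛ : IsLatticeOfRank r Λ) {n : Polynomial Fq} (hn : n ≠ 0) :
    Nat.card (Λ ⧸ (scaleSub (algebraMap (Polynomial Fq) L n) Λ).comap Λ.subtype) =
      (Fintype.card Fq ^ n.natDegree) ^ r := by
  obtain ⟨f, hf, hker⟩ := exists_reduction hΛ n
  have hg : f.ker = (scaleSub (algebraMap (Polynomial Fq) L n) Λ).comap Λ.subtype := by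
    ext x
    exact hker _
  rw [← hg, Nat.card_congr (f.quotKerEquivOfSurjective hf).toEquiv, Nat.card_fun,
    natCard_quotient_span hn, Nat.card_fin]

end Counting

lemma prod_erase_image_mul {c : L} (hc : c ≠ 0) (R : Finset L) (g : L → L) :
    ∏ w ∈ (R.image (c * ·)).erase 0, g w = ∏ w ∈ R.erase 0, g (c * w) := by
  have : (R.image (c * ·)).erase 0 = (R.erase 0).image (c * ·) := by
    simpa using (Finset.image_erase (mul_right_injective₀ hc) R 0).symm
  rw [this, Finset.prod_image (mul_right_injective₀ hc).injOn]

/-- Each nonzero class of `Λ / nΛ` lies in the same number `m` of members of `ℒ(Λ,(n),i)`, and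
`m` is determined by counting incidences. -/
lemma exists_incidence_count {r : ℕ} {Λ : Submodule (Polynomial Fq) L}
    (hΛ : IsLatticeOfRank r Λ) {n : Polynomial Fq} (hirr : Irreducible n) (i qd : ℕ)
    {R : Finset L} (hR : IsRepSet (scaleSub (algebraMap (Polynomial Fq) L n) Λ) Λ R)
    (h0 : (0 : L) ∈ R) {S : Finset (Submodule (Polynomial Fq) L)}
    (hS : ∀ Z, Z ∈ S ↔ Z ∈ lsetP n Λ i qd) :
    ∃ m ≤ S.card, (∀ u ∈ R.erase 0, (S.filter (u ∈ ·)).card = m) ∧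
      (m : ℤ) * ((R.card : ℤ) - 1) = S.card * ((qd : ℤ) ^ i - 1) := by
  have hconst : ∃ m ≤ S.card, ∀ u ∈ R.erase 0, (S.filter (u ∈ ·)).card = m := by
    rcases (R.erase 0).eq_empty_or_nonempty with h | ⟨v, hv⟩
    · exact ⟨0, Nat.zero_le _, by simp [h]⟩
    · refine ⟨_, Finset.card_filter_le S (v ∈ ·), fun u hu ↦ ?_⟩
      have hcard : ∀ x : L, (S.filter (x ∈ ·)).card =
          Nat.card {Z // Z ∈ lsetP n Λ i qd ∧ x ∈ Z} := by
        intro x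
        rw [← Nat.card_eq_finsetCard]
        exact Nat.card_congr (Equiv.subtypeEquivRight fun Z ↦ by simp [hS])
      rw [hcard, hcard]
      exact natCard_lsetP_mem_eq hΛ hirr i qd (hR.1 u (Finset.mem_of_mem_erase hu))
        (hR.1 v (Finset.mem_of_mem_erase hv)) (hR.notMem h0 hu) (hR.notMem h0 hv)
  obtain ⟨m, hm, hmu⟩ := hconst
  refine ⟨m, hm, hmu, ?_⟩
  have hdc := Finset.sum_card_bipartiteAbove_eq_sum_card_bipartiteBelow
    (s := R.erase 0) (t := S) (fun u Z ↦ u ∈ Z)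
  have h1 : ∑ u ∈ R.erase 0, (S.bipartiteAbove (fun u Z ↦ u ∈ Z) u).card =
      (R.erase 0).card * m := by
    rw [Finset.sum_const_nat]
    exact hmu
  have h2 : ∑ Z ∈ S, ((R.erase 0).bipartiteBelow (fun u Z ↦ u ∈ Z) Z).card =
      S.card * (qd ^ i - 1) := by
    rw [Finset.sum_const_nat]
    intro Z hZ
    have hZ' := (hS Z).1 hZ
    have hrep := hR.filter_mem hZ'.1 hZ'.2.1
    rw [Finset.bipartiteBelow, Finset.filter_erase,
      Finset.card_erase_of_mem (Finset.mem_filter.2 ⟨h0, Z.zero_mem⟩), hrep.card_eq, hZ'.2.2]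
  rw [h1, h2, Finset.card_erase_of_mem h0] at hdc
  have hRpos : 1 ≤ R.card := Finset.card_pos.2 ⟨0, h0⟩
  rcases S.eq_empty_or_nonempty with rfl | ⟨Z, hZ⟩
  · have : m = 0 := by simpa using hm
    simp [this]
  · have hZ' := (hS Z).1 hZ
    have hqd : 1 ≤ qd ^ i := by
      rw [← hZ'.2.2, ← (hR.filter_mem hZ'.1 hZ'.2.1).card_eq]
      exact Finset.card_pos.2 ⟨0, Finset.mem_filter.2 ⟨h0, Z.zero_mem⟩⟩
    zify [hRpos, hqd] at hdc
    linarith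

lemma prod_latExp_eq [IsUltrametricDist L] {Λ M : Submodule (Polynomial Fq) L}
    (hD : ∀ B : ℝ, {x : L | x ∈ Λ ∧ ‖x‖ ≤ B}.Finite) (hM : M ≤ Λ) {R : Finset L}
    (hR : IsRepSet M Λ R) (h0 : (0 : L) ∈ R) {S : Finset (Submodule (Polynomial Fq) L)}
    (hS : ∀ Z ∈ S, M ≤ Z ∧ Z ≤ Λ) {m : ℕ} (hm : m ≤ S.card)
    (hmu : ∀ u ∈ R.erase 0, (S.filter (u ∈ ·)).card = m) (z : L) :
    ∏ Z ∈ S, latExp Z z = latExp M z ^ (S.card - m) * latExp Λ z ^ m := by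
  have hDsub : ∀ Z ≤ Λ, ∀ B : ℝ, {x : L | x ∈ Z ∧ ‖x‖ ≤ B}.Finite :=
    fun Z hZ B ↦ (hD B).subset fun x hx ↦ ⟨hZ hx.1, hx.2⟩
  set g : L → L := fun u ↦ latExp M (u - z) / latExp M u
  have hZ : ∀ Z ∈ S, latExp Z z = latExp M z * ∏ u ∈ R.erase 0, if u ∈ Z then g u else 1 := by
    intro Z hZ
    rw [latExp_of_le (hDsub M hM) (hDsub Z (hS Z hZ).2) (hS Z hZ).1
      (hR.filter_mem (hS Z hZ).1 (hS Z hZ).2) (Finset.mem_filter.2 ⟨h0, Z.zero_mem⟩) z,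
      ← Finset.filter_erase, Finset.prod_filter]
  rw [Finset.prod_congr rfl hZ, Finset.prod_mul_distrib, Finset.prod_const, Finset.prod_comm]
  have hu : ∀ u ∈ R.erase 0, (∏ Z ∈ S, if u ∈ Z then g u else 1) = g u ^ m := by
    intro u hu
    rw [← Finset.prod_filter, Finset.prod_const, hmu u hu]
  rw [Finset.prod_congr rfl hu, Finset.prod_pow, latExp_of_le (hDsub M hM) hD hM hR h0 z, mul_pow,
    ← mul_assoc, ← pow_add, Nat.sub_add_cancel hm]

/-- Multiplicative Hecke action on the discriminant forms:
`∏_{Z ∈ ℒ(Λ,(n),i)} Δ^{Z'|Z} = n^{e'}·(Δ^{Λ'|Λ})^c` with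
`e' = (1 - [Λ':Λ])·c·q^{di}(q^{d(r-i)}-1)/(q^{dr}-1) ∈ ℤ`. -/
theorem statement3
    (q : ℕ) (hq : Fintype.card Fq = q)
    (hna : ∀ x y : L, ‖x + y‖ ≤ max ‖x‖ ‖y‖)
    (hA : ∀ a : Polynomial Fq, a ≠ 0 →
      ‖algebraMap (Polynomial Fq) L a‖ = (q : ℝ) ^ a.natDegree)
    (hval : ∀ x : L, x ≠ 0 → ∃ s : ℚ, ‖x‖ = (q : ℝ) ^ (s : ℝ))
    (r : ℕ)
    (Λ Λ' : Submodule (Polynomial Fq) L)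
    (hΛ : IsLatticeOfRank r Λ) (hΛ' : IsLatticeOfRank r Λ') (hle : Λ ≤ Λ')
    (hKeq : ∀ u : L, InKSpan Λ u ↔ InKSpan Λ' u)
    (n : Polynomial Fq) (hmon : n.Monic) (hirr : Irreducible n)
    (d : ℕ) (hd : n.natDegree = d)
    (htor : ∀ y ∈ Λ', n • y ∈ Λ → y ∈ Λ)
    (i : ℕ) (hi0 : 0 < i) (hir : i < r) :
    ∃ e' : ℤ,
      e' * ((q : ℤ) ^ (d * r) - 1) =
        (1 - (Nat.card (Λ' ⧸ Submodule.comap Λ'.subtype Λ) : ℤ)) *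
          ((Nat.card (lsetP n Λ i (q ^ d)) : ℤ) * (q : ℤ) ^ (d * i) *
            ((q : ℤ) ^ (d * (r - i)) - 1)) ∧
      (∏ᶠ Z ∈ lsetP n Λ i (q ^ d),
          latDisc Z (Z ⊔ scaleSub (algebraMap (Polynomial Fq) L n) Λ')) =
        (algebraMap (Polynomial Fq) L n) ^ e' *
          latDisc Λ Λ' ^ (Nat.card (lsetP n Λ i (q ^ d))) := by
  have hult : IsUltrametricDist L :=
    IsUltrametricDist.isUltrametricDist_of_forall_norm_add_le_max_norm hna
  have hn0 := hmon.ne_zero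
  have hq0 : (q : ℝ) ≠ 0 := by
    rw [← hq]
    exact_mod_cast Fintype.card_ne_zero
  have hν : algebraMap (Polynomial Fq) L n ≠ 0 := by
    rw [← norm_ne_zero_iff, hA n hn0]
    exact pow_ne_zero _ hq0
  have hfinite : Finite (Λ' ⧸ Λ.comap Λ'.subtype) :=
    finite_quotient_of_inKSpan hΛ' fun u hu ↦
      (hKeq u).2 ⟨1, one_ne_zero, by rwa [one_smul]⟩
  obtain ⟨R, hR, hR0⟩ := exists_isRepSet (Λ := Λ) (Λ' := Λ')
  have hMle := scaleSub_algebraMap_le n Λ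
  have hcardM := natCard_quotient_scaleSub hΛ hn0
  have : Finite (Λ ⧸ (scaleSub (algebraMap (Polynomial Fq) L n) Λ).comap Λ.subtype) := by
    refine Nat.finite_of_card_ne_zero ?_
    rw [hcardM]
    exact pow_ne_zero _ (pow_ne_zero _ Fintype.card_ne_zero)
  obtain ⟨T, hT, hT0⟩ := exists_isRepSet
    (Λ := scaleSub (algebraMap (Polynomial Fq) L n) Λ) (Λ' := Λ)
  have hfin := finite_lsetP hΛ hn0 i (q ^ d)
  have hS : ∀ Z, Z ∈ hfin.toFinset ↔ Z ∈ lsetP n Λ i (q ^ d) := fun Z ↦ hfin.mem_toFinset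
  obtain ⟨m, hm, hmu, hcount⟩ := exists_incidence_count hΛ hirr i (q ^ d) hT hT0 hS
  have hTcard : T.card = (q ^ d) ^ r := by rw [hT.card_eq, hcardM, hq, hd]
  have hc : Nat.card (lsetP n Λ i (q ^ d)) = hfin.toFinset.card :=
    Nat.card_eq_card_finite_toFinset hfin
  set S := hfin.toFinset
  rw [hc, ← hR.card_eq, finprod_mem_eq_finite_toFinset_prod _ hfin]
  have hRpos : 1 ≤ R.card := Finset.card_pos.2 ⟨0, hR0⟩
  refine ⟨-(((S.card - m) * (R.card - 1) : ℕ) : ℤ), ?_, ?_⟩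
  · have hpow : (q : ℤ) ^ (d * r) = (q : ℤ) ^ (d * i) * (q : ℤ) ^ (d * (r - i)) := by
      rw [← pow_add, ← mul_add, Nat.add_sub_cancel' hir.le]
    rw [hTcard] at hcount
    push_cast [Nat.cast_sub hm, Nat.cast_sub hRpos] at hcount ⊢
    rw [← pow_mul, ← pow_mul] at hcount
    rw [hpow] at hcount ⊢
    linear_combination ((R.card : ℤ) - 1) * hcount
  · have hdisc : ∀ Z ∈ S, latDisc Z (Z ⊔ scaleSub (algebraMap (Polynomial Fq) L n) Λ') =
        (∏ w ∈ R.erase 0, latExp Z (algebraMap (Polynomial Fq) L n * w))⁻¹ := by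
      intro Z hZ
      have hZ' := (hS Z).1 hZ
      rw [latDisc_eq (fun B ↦ (hΛ.2 B).subset fun x hx ↦ ⟨hZ'.2.1 hx.1, hx.2⟩)
        (hR.image_mul_sup htor hZ'.1 hZ'.2.1) (Finset.mem_image.2 ⟨0, hR0, mul_zero _⟩),
        prod_erase_image_mul hν]
    have hperm : ∏ w ∈ R.erase 0, latExp Λ (algebraMap (Polynomial Fq) L n * w) =
        ∏ w ∈ R.erase 0, latExp Λ w := by
      rw [← prod_erase_image_mul hν]
      exact (hR.image_mul htor).prod_erase_eq hR (Finset.mem_image.2 ⟨0, hR0, mul_zero _⟩) hR0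
        fun z l hl ↦ latExp_add hΛ.2 z hl
    rw [Finset.prod_congr rfl hdisc, Finset.prod_inv_distrib, Finset.prod_comm,
      latDisc_eq hΛ.2 hR hR0]
    simp only [prod_latExp_eq hΛ.2 hMle hT hT0
      (fun Z hZ ↦ ⟨((hS Z).1 hZ).1, ((hS Z).1 hZ).2.1⟩) hm hmu, latExp_scaleSub hν, mul_pow,
      Finset.prod_mul_distrib, Finset.prod_pow, hperm, Finset.prod_const,
      Finset.card_erase_of_mem hR0]
    rw [zpow_neg, zpow_natCast, mul_assoc, ← pow_add, Nat.sub_add_cancel hm, mul_inv, inv_pow,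
      ← pow_mul, mul_comm (R.card - 1)]
end
end

section
/- Let Λ ⊆ Λ' ⊆ K·Λ be A-lattices of rank r in L and let R be a set of representatives of the classes of Λ'/Λ with 0 ∈ R. Define ε^{Λ'|Λ} := (∏_{0≠w∈R} ε_w^Λ)^{−1}. Then: (a) ε^{Λ'|Λ} = ε(Λ_N)^{[Λ':Λ]} · ε(Λ'_N)^{−1} for all sufficiently large rational N, where [Λ':Λ] := #(Λ'/Λ); (b) for every v ∈ K·Λ ∖ Λ': (∏_{w∈R} ε_{v+w}^Λ) · ε^{Λ'|Λ} = ε_v^{Λ'}; (c) (ε^{Λ'|Λ})^{q^r−1} = (ε^Λ)^{[Λ':Λ]} · (ε^{Λ'})^{−1}. -/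
open scoped Classical

noncomputable section

variable {Fq : Type*} [Field Fq] [Fintype Fq]
variable {L : Type*} [NormedField L] [CompleteSpace L]
variable [Algebra (Polynomial Fq) L]

/-- The set of nonzero `λ ∈ u + Λ` with `log λ ≤ N` (a finite set for a lattice `Λ`). -/
def ballSet (q : ℕ) (Λ : Submodule (Polynomial Fq) L) (u : L) (N : ℚ) : Set L :=
  {l : L | l ≠ 0 ∧ l - u ∈ Λ ∧ logq q l ≤ (N : ℝ)}

/-- The rational number `s` with `|z| = q^s` (whenever it exists; `0` otherwise). -/
def rlog (q : ℕ) (z : L) : ℚ :=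
  if h : ∃ s : ℚ, ‖z‖ = (q : ℝ) ^ (s : ℝ) then h.choose else 0

/-- The `1`-unit part `⟨z⟩ = z·ρ(log z)·sgn(z)⁻¹` of `z ∈ L^×`, relative to a compatible
system `ρ` of rational powers of the uniformizer `π = T⁻¹` and a sign function `sgn`. -/
def uPart (q : ℕ) (ρ : ℚ → L) (sgn : L → L) (z : L) : L :=
  z * ρ (rlog q z) * (sgn z)⁻¹

/-- `ε((u+Λ)_N) = ∏_{0≠λ∈u+Λ, log λ ≤ N} sgn λ` (a finite product for a lattice). -/
def sgnProd (q : ℕ) (sgn : L → L) (Λ : Submodule (Polynomial Fq) L) (u : L) (N : ℚ) : L :=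
  ∏ᶠ l ∈ ballSet q Λ u N, sgn l

/-- `ε_u^Λ`: the root of unity characterized by
`∏_{0≠λ∈u+Λ, log λ ≤ N} sgn λ = ε_u^Λ · ε(Λ_N)` for all sufficiently large rational `N`
(it is unique when it exists; defined via choice). -/
def epsOf (q : ℕ) (sgn : L → L) (Λ : Submodule (Polynomial Fq) L) (u : L) : L :=
  if h : ∃ e : L, ∃ N₀ : ℚ, ∀ N : ℚ, N₀ ≤ N →
      sgnProd q sgn Λ u N = e * sgnProd q sgn Λ 0 N then
    h.choose
  else 1

/-- `ε^Λ`: the root of unity characterized by `ε^Λ = ε(Λ_N)^{q^r}·ε(Λ_{N+1})⁻¹` for all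
sufficiently large rational `N` (unique when it exists; defined via choice). -/
def epsLat (q r : ℕ) (sgn : L → L) (Λ : Submodule (Polynomial Fq) L) : L :=
  if h : ∃ e : L, ∃ N₀ : ℚ, ∀ N : ℚ, N₀ ≤ N →
      sgnProd q sgn Λ 0 N ^ (q ^ r) = e * sgnProd q sgn Λ 0 (N + 1) then
    h.choose
  else 1

open Filter

section RootsOfUnity

/-- In positive characteristic, no root of unity other than `1` is a `1`-unit. -/
theorem eq_one_of_pow_eq_one_of_norm_sub_one_lt {F : Type*} [NormedField F] (p : ℕ)
    [Fact p.Prime] [CharP F p] {ζ : F} {k : ℕ} (hk : 0 < k) (hζ : ζ ^ k = 1)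
    (h : ‖ζ - 1‖ < 1) : ζ = 1 := by
  have : NeZero k := ⟨hk.ne'⟩
  obtain ⟨i, j, hij, he⟩ :=
    Finite.exists_ne_map_eq_of_infinite (fun n : ℕ => ((p ^ n : ℕ) : ZMod k))
  have hmod : p ^ i ≡ p ^ j [MOD k] := (ZMod.natCast_eq_natCast_iff _ _ _).1 he
  have hpow : ζ ^ p ^ i = ζ ^ p ^ j := by
    rw [← Nat.div_add_mod (p ^ i) k, ← Nat.div_add_mod (p ^ j) k, pow_add, pow_add, pow_mul,
      pow_mul, hζ, one_pow, one_pow, hmod]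
  have hsub : ‖ζ - 1‖ ^ p ^ i = ‖ζ - 1‖ ^ p ^ j := by
    rw [← norm_pow, ← norm_pow, sub_pow_char_pow, sub_pow_char_pow, hpow, one_pow, one_pow]
  by_contra hne
  have hpos : 0 < ‖ζ - 1‖ := norm_pos_iff.2 (sub_ne_zero.2 hne)
  exact hij (Nat.pow_right_injective (Fact.out : p.Prime).two_le
    (pow_right_injective₀ hpos h.ne hsub))

variable {F : Type*} [NormedField F]

theorem norm_eq_of_norm_sub_lt (hna : ∀ x y : F, ‖x + y‖ ≤ max ‖x‖ ‖y‖) {x y : F}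
    (h : ‖y - x‖ < ‖x‖) : ‖y‖ = ‖x‖ := by
  have h1 := hna (y - x) x
  have h2 := hna (x - y) y
  rw [sub_add_cancel] at h1 h2
  rw [norm_sub_rev] at h2
  rcases le_max_iff.1 h1 with h1 | h1 <;> rcases le_max_iff.1 h2 with h2 | h2 <;> linarith

theorem norm_mul_sub_one_lt (hna : ∀ x y : F, ‖x + y‖ ≤ max ‖x‖ ‖y‖) {x y : F}
    (hx : ‖x - 1‖ < 1) (hy : ‖y - 1‖ < 1) :
    ‖x * y - 1‖ < 1 := by
  have hy1 : ‖y‖ = 1 := by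
    simpa using norm_eq_of_norm_sub_lt hna (x := 1) (y := y) (by simpa using hy)
  have h := hna ((x - 1) * y) (y - 1)
  rw [norm_mul, hy1, mul_one] at h
  calc ‖x * y - 1‖ = ‖(x - 1) * y + (y - 1)‖ := by congr 1; ring
    _ < 1 := h.trans_lt (max_lt hx hy)

theorem norm_inv_sub_one_lt (hna : ∀ x y : F, ‖x + y‖ ≤ max ‖x‖ ‖y‖) {x : F}
    (hx : ‖x - 1‖ < 1) : ‖x⁻¹ - 1‖ < 1 := by
  have hx1 : ‖x‖ = 1 := by
    simpa using norm_eq_of_norm_sub_lt hna (x := 1) (y := x) (by simpa using hx)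
  have hx0 : x ≠ 0 := norm_ne_zero_iff.1 (by rw [hx1]; exact one_ne_zero)
  have : x⁻¹ - 1 = x⁻¹ * (1 - x) := by field_simp
  rwa [this, norm_mul, norm_inv, hx1, inv_one, one_mul, norm_sub_rev]

end RootsOfUnity

section Sign

variable {F : Type*} [NormedField F] {q : ℕ} {ρ : ℚ → F} {sgn : F → F}

theorem rlog_eq_of_norm_eq {z z' : F} (h : ‖z'‖ = ‖z‖) : rlog q z' = rlog q z := by
  simp only [rlog, h]

theorem rlog_eq_of_norm_eq_rpow (hq : 1 < q) {z : F} {s : ℚ} (h : ‖z‖ = (q : ℝ) ^ (s : ℝ)) :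
    rlog q z = s := by
  have hex : ∃ s : ℚ, ‖z‖ = (q : ℝ) ^ (s : ℝ) := ⟨s, h⟩
  have hq1 : (1 : ℝ) < q := by exact_mod_cast hq
  rw [rlog, dif_pos hex]
  have := hex.choose_spec.symm.trans h
  exact_mod_cast (Real.strictMono_rpow_of_base_gt_one hq1).injective this

theorem sgn_ne_zero
    (hsgn : ∀ z : F, z ≠ 0 → (∃ k : ℕ, 0 < k ∧ sgn z ^ k = 1) ∧ ‖uPart q ρ sgn z - 1‖ < 1)
    {z : F} (hz : z ≠ 0) : sgn z ≠ 0 := by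
  obtain ⟨⟨k, hk, h⟩, -⟩ := hsgn z hz
  intro h0
  rw [h0, zero_pow hk.ne'] at h
  exact zero_ne_one h

/-- The sign depends only on the class of `z·ρ(log z)` modulo `1`-units. -/
theorem sgn_eq_of_norm_div_sub_one_lt (p : ℕ) [Fact p.Prime] [CharP F p]
    (hna : ∀ x y : F, ‖x + y‖ ≤ max ‖x‖ ‖y‖)
    (hsgn : ∀ z : F, z ≠ 0 → (∃ k : ℕ, 0 < k ∧ sgn z ^ k = 1) ∧ ‖uPart q ρ sgn z - 1‖ < 1)
    {z z' : F} (hz : z ≠ 0) (hz' : z' ≠ 0)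
    (h : ‖z' * ρ (rlog q z') / (z * ρ (rlog q z)) - 1‖ < 1) : sgn z' = sgn z := by
  have hs := sgn_ne_zero hsgn hz
  have hs' := sgn_ne_zero hsgn hz'
  obtain ⟨⟨k, hk, hkz⟩, hu⟩ := hsgn z hz
  obtain ⟨⟨k', hk', hkz'⟩, hu'⟩ := hsgn z' hz'
  have ha' : z' * ρ (rlog q z') ≠ 0 := by
    intro h0
    simp [uPart, h0] at hu'
  have ha : z * ρ (rlog q z) ≠ 0 := by
    intro h0
    simp [uPart, h0] at hu
  have key := norm_mul_sub_one_lt hna (norm_mul_sub_one_lt hna h hu) (norm_inv_sub_one_lt hna hu')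
  have heq : z' * ρ (rlog q z') / (z * ρ (rlog q z)) * uPart q ρ sgn z * (uPart q ρ sgn z')⁻¹ =
      sgn z' / sgn z := by
    simp only [uPart]
    generalize z' * ρ (rlog q z') = a' at *
    generalize z * ρ (rlog q z) = a at *
    field_simp
  rw [heq] at key
  have hroot : (sgn z' / sgn z) ^ (k * k') = 1 := by
    rw [div_pow, pow_mul (sgn z), hkz, mul_comm, pow_mul, hkz', one_pow, one_pow, div_one]
  exact (div_eq_one_iff_eq hs).1
    (eq_one_of_pow_eq_one_of_norm_sub_one_lt p (Nat.mul_pos hk hk') hroot key)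

theorem sgn_eq_of_norm_sub_lt (p : ℕ) [Fact p.Prime] [CharP F p]
    (hna : ∀ x y : F, ‖x + y‖ ≤ max ‖x‖ ‖y‖)
    (hsgn : ∀ z : F, z ≠ 0 → (∃ k : ℕ, 0 < k ∧ sgn z ^ k = 1) ∧ ‖uPart q ρ sgn z - 1‖ < 1)
    {z z' : F} (h : ‖z' - z‖ < ‖z‖) : sgn z' = sgn z := by
  have hz : z ≠ 0 := norm_pos_iff.1 ((norm_nonneg _).trans_lt h)
  have hn := norm_eq_of_norm_sub_lt hna h
  have hz' : z' ≠ 0 := norm_ne_zero_iff.1 (hn ▸ norm_ne_zero_iff.2 hz)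
  refine sgn_eq_of_norm_div_sub_one_lt p hna hsgn hz hz' ?_
  have hρ0 : ρ (rlog q z) ≠ 0 := by
    intro h0
    have hu := (hsgn z hz).2
    simp [uPart, h0] at hu
  rw [rlog_eq_of_norm_eq hn, mul_div_mul_right _ _ hρ0, div_sub_one hz, norm_div]
  exact (div_lt_one (norm_pos_iff.2 hz)).2 h

/-- The sign is invariant under multiplication by the inverse of the uniformizer. -/
theorem sgn_mul_eq (p : ℕ) [Fact p.Prime] [CharP F p]
    (hna : ∀ x y : F, ‖x + y‖ ≤ max ‖x‖ ‖y‖) (hq : 1 < q)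
    (hval : ∀ x : F, x ≠ 0 → ∃ s : ℚ, ‖x‖ = (q : ℝ) ^ (s : ℝ))
    (hρ : ∀ x y : ℚ, ρ (x + y) = ρ x * ρ y)
    (hsgn : ∀ z : F, z ≠ 0 → (∃ k : ℕ, 0 < k ∧ sgn z ^ k = 1) ∧ ‖uPart q ρ sgn z - 1‖ < 1)
    {t : F} (ht : ‖t‖ = q) (hρt : ρ 1 * t = 1) {z : F} (hz : z ≠ 0) : sgn (t * z) = sgn z := by
  have ht0 : t ≠ 0 := right_ne_zero_of_mul_eq_one hρt
  have hρ0 : ρ (rlog q z) ≠ 0 := by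
    intro h0
    have hu := (hsgn z hz).2
    simp [uPart, h0] at hu
  obtain ⟨s, hs⟩ := hval z hz
  have hrlog : rlog q (t * z) = s + 1 := by
    refine rlog_eq_of_norm_eq_rpow hq ?_
    have hq0 : (0 : ℝ) < q := by exact_mod_cast (zero_lt_one.trans hq)
    rw [norm_mul, ht, hs]
    push_cast
    rw [Real.rpow_add hq0, Real.rpow_one, mul_comm]
  refine sgn_eq_of_norm_div_sub_one_lt p hna hsgn hz (mul_ne_zero ht0 hz) ?_
  have : t * z * ρ (rlog q (t * z)) = z * ρ (rlog q z) := by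
    rw [hrlog, rlog_eq_of_norm_eq_rpow hq hs, hρ]
    linear_combination z * ρ s * hρt
  rw [this, div_self (mul_ne_zero hz hρ0)]
  simp

end Sign

section SignProducts

variable {k F : Type*} [Field k] [NormedField F] [Algebra (Polynomial k) F]
variable {q : ℕ} {sgn : F → F} {Λ Λ' : Submodule (Polynomial k) F}

theorem mem_ballSet_iff (hq : 1 < q) {u l : F} {N : ℚ} :
    l ∈ ballSet q Λ u N ↔ l ≠ 0 ∧ l - u ∈ Λ ∧ ‖l‖ ≤ (q : ℝ) ^ (N : ℝ) := by
  have hq1 : (1 : ℝ) < q := by exact_mod_cast hq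
  simp only [ballSet, Set.mem_ofPred_eq, logq]
  exact and_congr_right fun hl => and_congr_right fun _ =>
    Real.logb_le_iff_le_rpow hq1 (norm_pos_iff.2 hl)

theorem finite_ballSet (hq : 1 < q) (hd : ∀ B : ℝ, {x : F | x ∈ Λ ∧ ‖x‖ ≤ B}.Finite)
    (u : F) (N : ℚ) : (ballSet q Λ u N).Finite := by
  refine ((hd ((q : ℝ) ^ (N : ℝ) + ‖u‖)).image (· + u)).subset fun l hl => ?_
  obtain ⟨-, h, hN⟩ := (mem_ballSet_iff hq).1 hl
  exact ⟨l - u, ⟨h, (norm_sub_le _ _).trans (by gcongr)⟩, sub_add_cancel _ _⟩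

theorem sgnProd_ne_zero (h0 : ∀ z : F, z ≠ 0 → sgn z ≠ 0) (u : F) (N : ℚ) :
    sgnProd q sgn Λ u N ≠ 0 :=
  finprod_mem_induction (· ≠ 0) one_ne_zero (fun _ _ => mul_ne_zero) fun _ hl => h0 _ hl.1

/-- Translating a lattice by `u` does not affect the signs of its elements larger than `u`. -/
theorem sgnProd_mul_sgnProd_zero (hna : ∀ x y : F, ‖x + y‖ ≤ max ‖x‖ ‖y‖) (hq : 1 < q)
    (hd : ∀ B : ℝ, {x : F | x ∈ Λ ∧ ‖x‖ ≤ B}.Finite)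
    (hs : ∀ z z' : F, ‖z' - z‖ < ‖z‖ → sgn z' = sgn z)
    {u : F} {M N : ℚ} (hu : ‖u‖ ≤ (q : ℝ) ^ (M : ℝ)) (hMN : M ≤ N) :
    sgnProd q sgn Λ u N * sgnProd q sgn Λ 0 M = sgnProd q sgn Λ u M * sgnProd q sgn Λ 0 N := by
  have hq1 : (1 : ℝ) ≤ q := by exact_mod_cast hq.le
  have split (v : F) : sgnProd q sgn Λ v N =
      sgnProd q sgn Λ v M * ∏ᶠ l ∈ ballSet q Λ v N \ ballSet q Λ v M, sgn l := by
    refine (finprod_mem_mul_sdiff ?_ (finite_ballSet hq hd v N)).symm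
    intro l hl
    rw [mem_ballSet_iff hq] at hl ⊢
    refine ⟨hl.1, hl.2.1, hl.2.2.trans ?_⟩
    exact Real.rpow_le_rpow_of_exponent_le hq1 (by exact_mod_cast hMN)
  have mem_shell (v l : F) : l ∈ ballSet q Λ v N \ ballSet q Λ v M ↔
      l - v ∈ Λ ∧ ‖l‖ ≤ (q : ℝ) ^ (N : ℝ) ∧ (q : ℝ) ^ (M : ℝ) < ‖l‖ := by
    rw [Set.mem_sdiff, mem_ballSet_iff hq, mem_ballSet_iff hq]
    constructor
    · rintro ⟨⟨h1, h2, h3⟩, h4⟩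
      exact ⟨h2, h3, not_le.1 fun h5 => h4 ⟨h1, h2, h5⟩⟩
    · rintro ⟨h2, h3, h5⟩
      exact ⟨⟨norm_pos_iff.1 (lt_of_le_of_lt (by positivity) h5), h2, h3⟩,
        fun h => h5.not_ge h.2.2⟩
  have shell : ∏ᶠ l ∈ ballSet q Λ 0 N \ ballSet q Λ 0 M, sgn l =
      ∏ᶠ l ∈ ballSet q Λ u N \ ballSet q Λ u M, sgn l := by
    refine finprod_mem_eq_of_bijOn (· + u) ⟨?_, (add_left_injective u).injOn, ?_⟩ ?_
    · intro l hl
      rw [mem_shell] at hl ⊢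
      have hn : ‖l + u‖ = ‖l‖ := norm_eq_of_norm_sub_lt hna
        (by rw [add_sub_cancel_left]; exact hu.trans_lt hl.2.2)
      rw [hn]
      exact ⟨by simpa using hl.1, hl.2⟩
    · intro l hl
      refine ⟨l - u, ?_, sub_add_cancel _ _⟩
      rw [mem_shell] at hl ⊢
      have hn : ‖l - u‖ = ‖l‖ := norm_eq_of_norm_sub_lt hna
        (by rw [sub_sub_cancel_left, norm_neg]; exact hu.trans_lt hl.2.2)
      rw [hn]
      exact ⟨by simpa using hl.1, hl.2⟩
    · intro l hl
      rw [mem_shell] at hl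
      exact (hs l (l + u) (by rw [add_sub_cancel_left]; exact hu.trans_lt hl.2.2)).symm
  rw [split u, split 0, shell]
  ring

theorem epsOf_spec (hna : ∀ x y : F, ‖x + y‖ ≤ max ‖x‖ ‖y‖) (hq : 1 < q)
    (hd : ∀ B : ℝ, {x : F | x ∈ Λ ∧ ‖x‖ ≤ B}.Finite)
    (h0 : ∀ z : F, z ≠ 0 → sgn z ≠ 0)
    (hs : ∀ z z' : F, ‖z' - z‖ < ‖z‖ → sgn z' = sgn z) (u : F) :
    ∀ᶠ N : ℚ in atTop, sgnProd q sgn Λ u N = epsOf q sgn Λ u * sgnProd q sgn Λ 0 N := by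
  have hq1 : (1 : ℝ) < q := by exact_mod_cast hq
  have hex : ∃ e : F, ∃ N₀ : ℚ, ∀ N : ℚ, N₀ ≤ N →
      sgnProd q sgn Λ u N = e * sgnProd q sgn Λ 0 N := by
    obtain ⟨m, hm⟩ := pow_unbounded_of_one_lt ‖u‖ hq1
    refine ⟨sgnProd q sgn Λ u m / sgnProd q sgn Λ 0 m, m, fun N hN => ?_⟩
    rw [div_mul_eq_mul_div, eq_div_iff (sgnProd_ne_zero h0 _ _)]
    exact sgnProd_mul_sgnProd_zero hna hq hd hs (by simpa using hm.le) hN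
  rw [epsOf, dif_pos hex]
  exact eventually_atTop.2 hex.choose_spec

theorem epsOf_eq_of_eventually (h0 : ∀ z : F, z ≠ 0 → sgn z ≠ 0) {u e : F}
    (h : ∀ᶠ N : ℚ in atTop, sgnProd q sgn Λ u N = e * sgnProd q sgn Λ 0 N) :
    epsOf q sgn Λ u = e := by
  have hex : ∃ e : F, ∃ N₀ : ℚ, ∀ N : ℚ, N₀ ≤ N →
      sgnProd q sgn Λ u N = e * sgnProd q sgn Λ 0 N := ⟨e, eventually_atTop.1 h⟩
  rw [epsOf, dif_pos hex]
  obtain ⟨N, h1, h2⟩ := (h.and (eventually_atTop.2 hex.choose_spec)).exists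
  exact mul_right_cancel₀ (sgnProd_ne_zero h0 0 N) (h2.symm.trans h1)

theorem epsOf_zero (h0 : ∀ z : F, z ≠ 0 → sgn z ≠ 0) : epsOf q sgn Λ 0 = 1 :=
  epsOf_eq_of_eventually h0 (by simp)

theorem epsOf_ne_zero (hna : ∀ x y : F, ‖x + y‖ ≤ max ‖x‖ ‖y‖) (hq : 1 < q)
    (hd : ∀ B : ℝ, {x : F | x ∈ Λ ∧ ‖x‖ ≤ B}.Finite)
    (h0 : ∀ z : F, z ≠ 0 → sgn z ≠ 0)
    (hs : ∀ z z' : F, ‖z' - z‖ < ‖z‖ → sgn z' = sgn z) (u : F) : epsOf q sgn Λ u ≠ 0 := by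
  obtain ⟨N, hN⟩ := (epsOf_spec hna hq hd h0 hs u).exists
  exact left_ne_zero_of_mul (hN ▸ sgnProd_ne_zero h0 u N)

/-- A coset of `Λ'` is the disjoint union of the cosets of `Λ` it contains. -/
theorem sgnProd_eq_prod_sgnProd (hq : 1 < q) (hle : Λ ≤ Λ')
    (hd : ∀ B : ℝ, {x : F | x ∈ Λ ∧ ‖x‖ ≤ B}.Finite) {R : Finset F} (hR : IsRepSet Λ Λ' R)
    (v : F) (N : ℚ) : sgnProd q sgn Λ' v N = ∏ w ∈ R, sgnProd q sgn Λ (v + w) N := by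
  have hU : ballSet q Λ' v N = ⋃ w ∈ (R : Set F), ballSet q Λ (v + w) N := by
    ext l
    simp only [Set.mem_iUnion, mem_ballSet_iff hq, exists_prop, Finset.mem_coe]
    constructor
    · rintro ⟨h1, h2, h3⟩
      obtain ⟨w, ⟨hw, hlw⟩, -⟩ := hR.2 _ h2
      exact ⟨w, hw, h1, by rwa [← sub_sub], h3⟩
    · rintro ⟨w, hw, h1, h2, h3⟩
      refine ⟨h1, ?_, h3⟩
      have := Λ'.add_mem (hle h2) (hR.1 w hw)
      rwa [← sub_sub, sub_add_cancel] at this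
  rw [sgnProd, hU, finprod_mem_biUnion ?_ R.finite_toSet fun w _ => finite_ballSet hq hd _ _,
    finprod_mem_coe_finset]
  · rfl
  · intro w hw w' hw' hne
    refine Set.disjoint_left.2 fun l hl hl' => hne ?_
    have h1 : l - v - w ∈ Λ := by rw [sub_sub]; exact hl.2.1
    have h2 : l - v - w' ∈ Λ := by rw [sub_sub]; exact hl'.2.1
    have hmem : l - v ∈ Λ' := by
      have := Λ'.add_mem (hle h1) (hR.1 w hw)
      rwa [sub_add_cancel] at this
    exact (hR.2 _ hmem).unique ⟨hw, h1⟩ ⟨hw', h2⟩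

theorem sgnProd_eventually_eq_of_isRepSet (hna : ∀ x y : F, ‖x + y‖ ≤ max ‖x‖ ‖y‖) (hq : 1 < q)
    (hd : ∀ B : ℝ, {x : F | x ∈ Λ ∧ ‖x‖ ≤ B}.Finite)
    (h0 : ∀ z : F, z ≠ 0 → sgn z ≠ 0)
    (hs : ∀ z z' : F, ‖z' - z‖ < ‖z‖ → sgn z' = sgn z) (hle : Λ ≤ Λ')
    {R : Finset F} (hR : IsRepSet Λ Λ' R) (v : F) :
    ∀ᶠ N : ℚ in atTop, sgnProd q sgn Λ' v N =
      (∏ w ∈ R, epsOf q sgn Λ (v + w)) * sgnProd q sgn Λ 0 N ^ R.card := by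
  have := (eventually_all_finset R).2 fun w _ => epsOf_spec hna hq hd h0 hs (v + w)
  filter_upwards [this] with N hN
  rw [sgnProd_eq_prod_sgnProd hq hle hd hR, Finset.prod_congr rfl hN, Finset.prod_mul_distrib,
    Finset.prod_const]

theorem card_quotient_eq_of_isRepSet {R : Finset F} (hR : IsRepSet Λ Λ' R) :
    Nat.card (Λ' ⧸ Submodule.comap Λ'.subtype Λ) = R.card := by
  let f : R → Λ' ⧸ Submodule.comap Λ'.subtype Λ :=
    fun w => Submodule.Quotient.mk ⟨w, hR.1 w w.2⟩
  have hf : Function.Bijective f := by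
    constructor
    · rintro ⟨w, hw⟩ ⟨w', hw'⟩ h
      rw [Submodule.Quotient.eq] at h
      exact Subtype.ext ((hR.2 w (hR.1 w hw)).unique ⟨hw, by simp⟩ ⟨hw', h⟩)
    · intro y
      obtain ⟨⟨y, hy⟩, rfl⟩ := Submodule.Quotient.mk_surjective _ y
      obtain ⟨w, ⟨hw, hyw⟩, -⟩ := hR.2 y hy
      refine ⟨⟨w, hw⟩, ((Submodule.Quotient.eq _).2 ?_).symm⟩
      exact hyw
  rw [← Nat.card_eq_of_bijective f hf, Nat.card_eq_fintype_card, Fintype.card_coe]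

end SignProducts

section MulByX

open Polynomial

variable {k F : Type*} [Field k] [NormedField F] [Algebra k[X] F]

/-- The sublattice `T·Λ` of `Λ`. -/
def mulX (Λ : Submodule k[X] F) : Submodule k[X] F :=
  Λ.map (LinearMap.lsmul k[X] F X)

theorem mem_mulX {Λ : Submodule k[X] F} {x : F} : x ∈ mulX Λ ↔ ∃ y ∈ Λ, (X : k[X]) • y = x :=
  Iff.rfl

theorem mulX_le (Λ : Submodule k[X] F) : mulX Λ ≤ Λ := by
  rintro _ ⟨y, hy, rfl⟩
  exact Λ.smul_mem X hy

/-- The polynomial combinations of a basis with constant coefficients represent `Λ / T·Λ`. -/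
theorem exists_isRepSet_mulX [Fintype k] {r : ℕ} {b : Fin r → F}
    (hb : LinearIndependent k[X] b) :
    ∃ R : Finset F, R.card = Fintype.card k ^ r ∧
      IsRepSet (mulX (Submodule.span k[X] (Set.range b))) (Submodule.span k[X] (Set.range b)) R := by
  let w : (Fin r → k) → F := fun f => ∑ i, C (f i) • b i
  have hsep (f g : Fin r → k)
      (h : w f - w g ∈ mulX (Submodule.span k[X] (Set.range b))) : f = g := by
    obtain ⟨y, hy, hyw⟩ := mem_mulX.1 h
    obtain ⟨c, rfl⟩ := (Submodule.mem_span_range_iff_exists_fun k[X]).1 hy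
    have hsum : ∑ i, (X * c i - (C (f i) - C (g i))) • b i = 0 := by
      simp only [sub_smul, mul_smul, Finset.sum_sub_distrib, ← Finset.smul_sum]
      rw [hyw, sub_self]
    funext i
    have hi := congrArg (eval 0) (Fintype.linearIndependent_iff.1 hb _ hsum i)
    simp only [eval_sub, eval_mul, eval_X, eval_C, zero_mul, zero_sub, eval_zero, neg_eq_zero] at hi
    exact sub_eq_zero.1 hi
  have hinj : Function.Injective w := fun f g h => hsep f g (by simp [h])
  refine ⟨Finset.univ.image w, ?_, ?_, ?_⟩
  · rw [Finset.card_image_of_injective _ hinj, Finset.card_univ, Fintype.card_fun,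
      Fintype.card_fin]
  · intro x hx
    obtain ⟨f, -, rfl⟩ := Finset.mem_image.1 hx
    exact Submodule.sum_mem _ fun i _ => Submodule.smul_mem _ _ (Submodule.subset_span ⟨i, rfl⟩)
  · intro y hy
    obtain ⟨c, rfl⟩ := (Submodule.mem_span_range_iff_exists_fun k[X]).1 hy
    have hmem : (∑ i, c i • b i) - w (fun i => (c i).coeff 0) ∈
        mulX (Submodule.span k[X] (Set.range b)) := by
      refine mem_mulX.2 ⟨∑ i, (c i).divX • b i, ?_, ?_⟩
      · exact Submodule.sum_mem _ fun i _ =>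
          Submodule.smul_mem _ _ (Submodule.subset_span ⟨i, rfl⟩)
      · rw [Finset.smul_sum, ← Finset.sum_sub_distrib]
        refine Finset.sum_congr rfl fun i _ => ?_
        rw [← sub_smul, smul_smul]
        congr 1
        rw [eq_sub_iff_add_eq, X_mul_divX_add]
    refine ⟨_, ⟨Finset.mem_image_of_mem w (Finset.mem_univ _), hmem⟩, ?_⟩
    rintro _ ⟨hx, hx'⟩
    obtain ⟨f, -, rfl⟩ := Finset.mem_image.1 hx
    refine congrArg w (hsep _ _ ?_)
    have := Submodule.sub_mem _ hmem hx'
    rwa [sub_sub_sub_cancel_left] at this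

variable {q : ℕ} {sgn : F → F} {Λ : Submodule k[X] F}

theorem sgnProd_mulX_add_one (hq : 1 < q) (hX : ‖algebraMap k[X] F X‖ = q)
    (hsX : ∀ z : F, z ≠ 0 → sgn (algebraMap k[X] F X * z) = sgn z) (N : ℚ) :
    sgnProd q sgn (mulX Λ) 0 (N + 1) = sgnProd q sgn Λ 0 N := by
  have hq0 : (0 : ℝ) < q := by exact_mod_cast zero_lt_one.trans hq
  have hX0 : algebraMap k[X] F X ≠ 0 := norm_ne_zero_iff.1 (hX ▸ hq0.ne')
  have hpow : (q : ℝ) ^ ((N + 1 : ℚ) : ℝ) = q * (q : ℝ) ^ (N : ℝ) := by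
    push_cast
    rw [Real.rpow_add hq0, Real.rpow_one, mul_comm]
  refine (finprod_mem_eq_of_bijOn (algebraMap k[X] F X * ·)
    ⟨?_, (mul_right_injective₀ hX0).injOn, ?_⟩ ?_).symm
  · intro l hl
    rw [mem_ballSet_iff hq, sub_zero] at hl ⊢
    refine ⟨mul_ne_zero hX0 hl.1, mem_mulX.2 ⟨l, hl.2.1, Algebra.smul_def _ _⟩, ?_⟩
    rw [norm_mul, hX, hpow]
    exact mul_le_mul_of_nonneg_left hl.2.2 hq0.le
  · intro l hl
    rw [mem_ballSet_iff hq, sub_zero] at hl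
    obtain ⟨h1, h2, h3⟩ := hl
    obtain ⟨y, hy, rfl⟩ := mem_mulX.1 h2
    rw [Algebra.smul_def] at h1 h3 ⊢
    refine ⟨y, (mem_ballSet_iff hq).2 ⟨right_ne_zero_of_mul h1, by rwa [sub_zero], ?_⟩, rfl⟩
    rw [norm_mul, hX, hpow] at h3
    exact le_of_mul_le_mul_left h3 hq0
  · intro l hl
    exact (hsX l hl.1).symm

theorem epsLat_spec [Fintype k] (hcard : Fintype.card k = q)
    (hna : ∀ x y : F, ‖x + y‖ ≤ max ‖x‖ ‖y‖) (hq : 1 < q)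
    (h0 : ∀ z : F, z ≠ 0 → sgn z ≠ 0)
    (hs : ∀ z z' : F, ‖z' - z‖ < ‖z‖ → sgn z' = sgn z)
    (hX : ‖algebraMap k[X] F X‖ = q)
    (hsX : ∀ z : F, z ≠ 0 → sgn (algebraMap k[X] F X * z) = sgn z)
    {r : ℕ} (hΛ : IsLatticeOfRank r Λ) :
    ∀ᶠ N : ℚ in atTop,
      sgnProd q sgn Λ 0 N ^ (q ^ r) = epsLat q r sgn Λ * sgnProd q sgn Λ 0 (N + 1) := by
  have hex : ∃ e : F, ∃ N₀ : ℚ, ∀ N : ℚ, N₀ ≤ N →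
      sgnProd q sgn Λ 0 N ^ (q ^ r) = e * sgnProd q sgn Λ 0 (N + 1) := by
    obtain ⟨⟨b, hb, rfl⟩, hd⟩ := hΛ
    obtain ⟨R, hRcard, hR⟩ := exists_isRepSet_mulX hb
    have hle := mulX_le (Submodule.span k[X] (Set.range b))
    have hd' (B : ℝ) : {x : F | x ∈ mulX (Submodule.span k[X] (Set.range b)) ∧ ‖x‖ ≤ B}.Finite :=
      (hd B).subset fun x hx => ⟨hle hx.1, hx.2⟩
    obtain ⟨N₀, hN₀⟩ := eventually_atTop.1
      (sgnProd_eventually_eq_of_isRepSet hna hq hd' h0 hs hle hR 0)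
    refine ⟨(∏ w ∈ R, epsOf q sgn (mulX (Submodule.span k[X] (Set.range b))) (0 + w))⁻¹, N₀, fun N hN => ?_⟩
    rw [hN₀ (N + 1) (by linarith), sgnProd_mulX_add_one hq hX hsX, hRcard, hcard,
      inv_mul_cancel_left₀]
    exact Finset.prod_ne_zero_iff.2 fun w _ => epsOf_ne_zero hna hq hd' h0 hs _
  rw [epsLat, dif_pos hex]
  exact eventually_atTop.2 hex.choose_spec

end MulByX

/-- For a lattice pair `Λ ⊆ Λ' ⊆ K·Λ` and a complete set `R` of
representatives of `Λ'/Λ` with `0 ∈ R`, set `ε^{Λ'|Λ} := (∏_{0≠w∈R} ε_w^Λ)⁻¹`. Then: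
(a) `ε^{Λ'|Λ} = ε(Λ_N)^{[Λ':Λ]}·ε(Λ'_N)⁻¹` for all sufficiently large rational `N`;
(b) `(∏_{w∈R} ε_{v+w}^Λ)·ε^{Λ'|Λ} = ε_v^{Λ'}` for every `v ∈ K·Λ ∖ Λ'`;
(c) `(ε^{Λ'|Λ})^{q^r-1} = (ε^Λ)^{[Λ':Λ]}·(ε^{Λ'})⁻¹`. -/
theorem statement15
    (q : ℕ) (hq : Fintype.card Fq = q)
    (hna : ∀ x y : L, ‖x + y‖ ≤ max ‖x‖ ‖y‖)
    (hA : ∀ a : Polynomial Fq, a ≠ 0 →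
      ‖algebraMap (Polynomial Fq) L a‖ = (q : ℝ) ^ a.natDegree)
    (hval : ∀ x : L, x ≠ 0 → ∃ s : ℚ, ‖x‖ = (q : ℝ) ^ (s : ℝ))
    (ρ : ℚ → L) (sgn : L → L)
    (hρ : ∀ x y : ℚ, ρ (x + y) = ρ x * ρ y)
    (hρ1 : ρ 1 * algebraMap (Polynomial Fq) L Polynomial.X = 1)
    (hsgn : ∀ z : L, z ≠ 0 →
      (∃ k : ℕ, 0 < k ∧ sgn z ^ k = 1) ∧ ‖uPart q ρ sgn z - 1‖ < 1)
    (r : ℕ)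
    (Λ Λ' : Submodule (Polynomial Fq) L)
    (hΛ : IsLatticeOfRank r Λ) (hΛ' : IsLatticeOfRank r Λ') (hle : Λ ≤ Λ')
    (hsub : ∀ u ∈ Λ', InKSpan Λ u)
    (R : Finset L) (hR : IsRepSet Λ Λ' R) (h0 : (0 : L) ∈ R) :
    (∃ N₀ : ℚ, ∀ N : ℚ, N₀ ≤ N →
      (∏ w ∈ R.erase 0, epsOf q sgn Λ w)⁻¹ =
        sgnProd q sgn Λ 0 N ^ (Nat.card (Λ' ⧸ Submodule.comap Λ'.subtype Λ)) *
          (sgnProd q sgn Λ' 0 N)⁻¹) ∧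
    (∀ v : L, InKSpan Λ v → v ∉ Λ' →
      (∏ w ∈ R, epsOf q sgn Λ (v + w)) * (∏ w ∈ R.erase 0, epsOf q sgn Λ w)⁻¹ =
        epsOf q sgn Λ' v) ∧
    ((∏ w ∈ R.erase 0, epsOf q sgn Λ w)⁻¹ ^ (q ^ r - 1) =
      epsLat q r sgn Λ ^ (Nat.card (Λ' ⧸ Submodule.comap Λ'.subtype Λ)) *
        (epsLat q r sgn Λ')⁻¹) := by
  have hq1 : 1 < q := hq ▸ Fintype.one_lt_card
  obtain ⟨p, hp⟩ := CharP.exists Fq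
  have : Fact p.Prime := ⟨CharP.char_is_prime Fq p⟩
  have : CharP L p := charP_of_injective_ringHom
    ((algebraMap (Polynomial Fq) L).comp Polynomial.C).injective p
  have hX : ‖algebraMap (Polynomial Fq) L Polynomial.X‖ = q := by
    rw [hA _ Polynomial.X_ne_zero, Polynomial.natDegree_X, pow_one]
  have hs0 (z : L) (hz : z ≠ 0) : sgn z ≠ 0 := sgn_ne_zero hsgn hz
  have hs (z z' : L) (h : ‖z' - z‖ < ‖z‖) : sgn z' = sgn z :=
    sgn_eq_of_norm_sub_lt p hna hsgn h
  have hsX (z : L) (hz : z ≠ 0) : sgn (algebraMap (Polynomial Fq) L Polynomial.X * z) = sgn z :=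
    sgn_mul_eq p hna hq1 hval hρ hsgn hX hρ1 hz
  have hrep := sgnProd_eventually_eq_of_isRepSet hna hq1 hΛ.2 hs0 hs hle hR
  have hne (Γ : Submodule (Polynomial Fq) L) (N : ℚ) : sgnProd q sgn Γ 0 N ≠ 0 :=
    sgnProd_ne_zero hs0 0 N
  have hP : ∏ w ∈ R.erase 0, epsOf q sgn Λ w ≠ 0 :=
    Finset.prod_ne_zero_iff.2 fun w _ => epsOf_ne_zero hna hq1 hΛ.2 hs0 hs w
  rw [card_quotient_eq_of_isRepSet hR]
  have ha : ∀ᶠ N : ℚ in atTop, (∏ w ∈ R.erase 0, epsOf q sgn Λ w)⁻¹ =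
      sgnProd q sgn Λ 0 N ^ R.card * (sgnProd q sgn Λ' 0 N)⁻¹ := by
    filter_upwards [hrep 0] with N hN
    simp only [zero_add] at hN
    rw [← Finset.mul_prod_erase R _ h0, epsOf_zero hs0, one_mul] at hN
    rw [hN, mul_inv, mul_left_comm, mul_inv_cancel₀ (pow_ne_zero _ (hne Λ N)), mul_one]
  refine ⟨eventually_atTop.1 ha, fun v _ _ => ?_, ?_⟩
  · refine (epsOf_eq_of_eventually hs0 ?_).symm
    filter_upwards [ha, hrep v] with N haN hN
    rw [hN, haN, mul_assoc, mul_assoc, inv_mul_cancel₀ (hne Λ' N), mul_one]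
  · have hl := epsLat_spec hq hna hq1 hs0 hs hX hsX hΛ
    have hl' := epsLat_spec hq hna hq1 hs0 hs hX hsX hΛ'
    have ha1 := (tendsto_atTop_add_const_right atTop (1 : ℚ) tendsto_id).eventually ha
    obtain ⟨N, ⟨haN, haN1⟩, hlN, hlN'⟩ := ((ha.and ha1).and (hl.and hl')).exists
    set E := (∏ w ∈ R.erase 0, epsOf q sgn Λ w)⁻¹ with hE
    have hE0 : E ≠ 0 := inv_ne_zero hP
    refine mul_left_cancel₀ hE0 ?_
    rw [mul_pow_sub_one (pow_pos (zero_lt_one.trans hq1) r).ne']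
    calc E ^ q ^ r = (sgnProd q sgn Λ 0 N ^ q ^ r) ^ R.card *
          (sgnProd q sgn Λ' 0 N ^ q ^ r)⁻¹ := by
          rw [haN, mul_pow, inv_pow, pow_right_comm]
      _ = (sgnProd q sgn Λ 0 (N + 1) ^ R.card * (sgnProd q sgn Λ' 0 (N + 1))⁻¹) *
          (epsLat q r sgn Λ ^ R.card * (epsLat q r sgn Λ')⁻¹) := by
          rw [hlN, hlN', mul_pow, mul_inv]
          ring
      _ = _ := congrArg (· * _) haN1.symm
end
end

section
/- Let r = 2 and let ω ∈ L satisfy |ω| = inf_{x∈K_∞} |ω − x| and |ω| = q^ℓ with ℓ a nonnegative integer (in particular ω ∉ K_∞). Then Λ := A·ω + A is an A-lattice of rank 2 in L, and the discriminant Δ_T(Λ) := T·(∏_w e^Λ(w))^{−1}, the product over a set of representatives w of the nonzero classes of (T^{−1}Λ)/Λ (independent of the choice), satisfies log Δ_T(Λ) = q² + q − q^{ℓ+1}. -/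
open scoped Classical

noncomputable section

variable {Fq : Type*} [Field Fq] [Fintype Fq]
variable {L : Type*} [NormedField L] [CompleteSpace L]
variable [Algebra (Polynomial Fq) L]

/-- `K_∞ ⊆ L`: the closure in `L` of the subfield `𝔽_q(T)` generated by the image of
`A = 𝔽_q[T]`; since `|·|` restricts to the `∞`-adic absolute value on `𝔽_q(T)`, this is a
copy of the completion `K_∞ = 𝔽_q((T⁻¹))`. -/
def Kinfty : Set L :=
  closure ((Subfield.closure (Set.range (algebraMap (Polynomial Fq) L)) : Subfield L) : Set L)

set_option linter.unusedSectionVars false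

lemma norm_eq_one_of_norm_sub_one_lt [IsUltrametricDist L] {x : L} (h : ‖x - 1‖ < 1) :
    ‖x‖ = 1 := by
  have h1 : ‖x - 1‖ ≠ ‖(1 : L)‖ := by rw [norm_one]; exact h.ne
  have h2 := IsUltrametricDist.norm_add_eq_max_of_norm_ne_norm h1
  rwa [sub_add_cancel, norm_one, max_eq_right h.le] at h2

lemma norm_prod_sub_one_le [IsUltrametricDist L] {ι : Type*} (f : ι → L) {ε : ℝ}
    (h0 : 0 ≤ ε) (h1 : ε ≤ 1) (s : Finset ι) (h : ∀ i ∈ s, ‖f i - 1‖ ≤ ε) :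
    ‖∏ i ∈ s, f i - 1‖ ≤ ε := by
  induction s using Finset.induction_on with
  | empty => simpa using h0
  | insert a s ha ih =>
    have ih' := ih fun i hi => h i (Finset.mem_insert_of_mem hi)
    have hfa := h a (Finset.mem_insert_self a s)
    rw [Finset.prod_insert ha]
    have e : f a * ∏ i ∈ s, f i - 1
        = (f a - 1) * (∏ i ∈ s, f i - 1) + ((f a - 1) + (∏ i ∈ s, f i - 1)) := by ring
    rw [e]
    refine (IsUltrametricDist.norm_add_le_max _ _).trans (max_le ?_ ?_)
    · rw [norm_mul]
      calc ‖f a - 1‖ * ‖∏ i ∈ s, f i - 1‖ ≤ 1 * ε :=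
            mul_le_mul (hfa.trans h1) ih' (norm_nonneg _) zero_le_one
        _ = ε := one_mul ε
    · exact (IsUltrametricDist.norm_add_le_max _ _).trans (max_le hfa ih')

/-- In a complete ultrametric field, a family tending to `1` along the cofinite filter has an
unconditional product, whose absolute value is read off from finitely many factors. -/
lemma norm_tprod_eq_of_tendsto_one [IsUltrametricDist L] {ι : Type*} (f : ι → L)
    (hf : ∀ ε > 0, {i | ε ≤ ‖f i - 1‖}.Finite) (s : Finset ι) (hs : ∀ i ∉ s, ‖f i - 1‖ < 1) :
    ‖∏' i, f i‖ = ∏ i ∈ s, ‖f i‖ := by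
  have hnorm : ∀ t, s ⊆ t → ‖∏ i ∈ t, f i‖ = ∏ i ∈ s, ‖f i‖ := by
    intro t hst
    rw [norm_prod]
    refine (Finset.prod_subset hst fun i _ hi => ?_).symm
    exact norm_eq_one_of_norm_sub_one_lt (hs i hi)
  set C := ∏ i ∈ s, ‖f i‖ with hC
  have hC0 : 0 ≤ C := Finset.prod_nonneg fun i _ => norm_nonneg _
  have hcauchy : CauchySeq fun t : Finset ι => ∏ i ∈ t, f i := by
    rw [Metric.cauchySeq_iff']
    intro ε hε
    obtain ⟨δ, hδ0, hδ1, hδ⟩ : ∃ δ : ℝ, 0 < δ ∧ δ ≤ 1 ∧ C * δ < ε := by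
      refine ⟨min 1 (ε / (C + 1)), by positivity, min_le_left _ _, ?_⟩
      calc C * min 1 (ε / (C + 1)) ≤ C * (ε / (C + 1)) := by gcongr; exact min_le_right _ _
        _ < ε := by
          rw [mul_div_assoc', div_lt_iff₀ (by positivity)]
          nlinarith
    refine ⟨s ∪ (hf δ hδ0).toFinset, fun t ht => ?_⟩
    rw [dist_eq_norm, ← Finset.prod_sdiff ht]
    set u := s ∪ (hf δ hδ0).toFinset
    have e : (∏ i ∈ t \ u, f i) * (∏ i ∈ u, f i) - ∏ i ∈ u, f i
        = (∏ i ∈ u, f i) * (∏ i ∈ t \ u, f i - 1) := by ring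
    rw [e, norm_mul, hnorm u Finset.subset_union_left]
    refine lt_of_le_of_lt (mul_le_mul_of_nonneg_left ?_ hC0) hδ
    refine norm_prod_sub_one_le f hδ0.le hδ1 _ fun i hi => ?_
    by_contra hcon
    refine (Finset.mem_sdiff.1 hi).2 (Finset.mem_union_right _ ?_)
    simpa using (not_le.1 hcon).le
  obtain ⟨P, hP⟩ := cauchySeq_tendsto_of_complete hcauchy
  have hprod : HasProd f P := by
    simpa [HasProd] using hP
  rw [hprod.tprod_eq]
  refine tendsto_nhds_unique hP.norm (tendsto_const_nhds.congr' ?_)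
  filter_upwards [Filter.eventually_ge_atTop s] with t ht
  exact (hnorm t ht).symm

lemma norm_latExp [IsUltrametricDist L] (Λ : Submodule (Polynomial Fq) L)
    (hfin : ∀ B : ℝ, {x : L | x ∈ Λ ∧ ‖x‖ ≤ B}.Finite) (w : L) (s : Finset L)
    (hs : ∀ x ∈ s, x ∈ Λ ∧ x ≠ 0) (hw : ∀ x ∈ Λ, x ≠ 0 → x ∉ s → ‖w‖ < ‖x‖) :
    ‖latExp Λ w‖ = ‖w‖ * ∏ x ∈ s, ‖1 - w / x‖ := by
  have hn : ∀ x : L, ‖(1 - w / x) - 1‖ = ‖w‖ / ‖x‖ := fun x => by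
    rw [sub_sub_cancel_left, norm_neg, norm_div]
  rw [latExp, norm_mul,
    norm_tprod_eq_of_tendsto_one _ ?_ (s.subtype fun x => x ∈ Λ ∧ x ≠ 0) ?_]
  · congr 1
    exact Finset.prod_subtype_of_mem (fun x => ‖1 - w / x‖) hs
  · intro ε hε
    refine Set.Finite.of_finite_image (f := Subtype.val) ((hfin (‖w‖ / ε)).subset ?_)
      Subtype.val_injective.injOn
    rintro _ ⟨x, hx, rfl⟩
    refine ⟨x.2.1, ?_⟩
    have hx' : ε ≤ ‖w‖ / ‖(x : L)‖ := by rw [← hn]; exact hx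
    have h0 : 0 < ‖(x : L)‖ := norm_pos_iff.2 x.2.2
    rw [le_div_iff₀ h0] at hx'
    rw [le_div_iff₀ hε]
    linarith
  · intro x hx
    rw [hn, div_lt_one (norm_pos_iff.2 x.2.2)]
    exact hw x x.2.1 x.2.2 (by simpa [x.2] using hx)

lemma norm_latExp_eq_div [IsUltrametricDist L] (Λ : Submodule (Polynomial Fq) L)
    (hfin : ∀ B : ℝ, {x : L | x ∈ Λ ∧ ‖x‖ ≤ B}.Finite) (w : L) {B : ℝ} (hB : ‖w‖ ≤ B) :
    ‖latExp Λ w‖ = (∏ x ∈ (hfin B).toFinset, ‖w - x‖) /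
      ∏ x ∈ (hfin B).toFinset.erase 0, ‖x‖ := by
  have h0 : (0 : L) ∈ (hfin B).toFinset := by
    simpa using (norm_nonneg w).trans hB
  rw [norm_latExp Λ hfin w ((hfin B).toFinset.erase 0), ← Finset.mul_prod_erase _ _ h0, sub_zero,
    mul_div_assoc, ← Finset.prod_div_distrib]
  · congr 1
    refine Finset.prod_congr rfl fun x hx => ?_
    have hx0 : x ≠ 0 := (Finset.mem_erase.1 hx).1
    rw [one_sub_div hx0, norm_div, norm_sub_rev]
  · intro x hx
    rw [Finset.mem_erase, Set.Finite.mem_toFinset] at hx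
    exact ⟨hx.2.1, hx.1⟩
  · intro x hx hx0 hxs
    by_contra hcon
    refine hxs (Finset.mem_erase.2 ⟨hx0, ?_⟩)
    rw [Set.Finite.mem_toFinset]
    exact ⟨hx, (not_lt.1 hcon).trans hB⟩

lemma norm_latExp_congr [IsUltrametricDist L] (Λ : Submodule (Polynomial Fq) L)
    (hfin : ∀ B : ℝ, {x : L | x ∈ Λ ∧ ‖x‖ ≤ B}.Finite) {w w' : L} (hww : w - w' ∈ Λ) :
    ‖latExp Λ w‖ = ‖latExp Λ w'‖ := by
  set B := max ‖w‖ ‖w'‖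
  have hμ : ‖w - w'‖ ≤ B := by
    rw [sub_eq_add_neg]
    exact (IsUltrametricDist.norm_add_le_max _ _).trans_eq (by rw [norm_neg])
  rw [norm_latExp_eq_div Λ hfin w (le_max_left _ _ : ‖w‖ ≤ B),
    norm_latExp_eq_div Λ hfin w' (le_max_right _ _ : ‖w'‖ ≤ B)]
  congr 1
  refine Finset.prod_nbij' (fun x => x - (w - w')) (fun x => x + (w - w')) ?_ ?_ ?_ ?_ ?_
  · intro x hx
    rw [Set.Finite.mem_toFinset] at hx ⊢
    refine ⟨Λ.sub_mem hx.1 hww, ?_⟩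
    rw [sub_eq_add_neg]
    refine (IsUltrametricDist.norm_add_le_max _ _).trans (max_le hx.2 ?_)
    rwa [norm_neg]
  · intro x hx
    rw [Set.Finite.mem_toFinset] at hx ⊢
    exact ⟨Λ.add_mem hx.1 hww, (IsUltrametricDist.norm_add_le_max _ _).trans (max_le hx.2 hμ)⟩
  · intro x _; simp
  · intro x _; simp
  · intro x _
    congr 1
    ring

/-- The polynomials of degree less than `n`, as a finite set. -/
def polysLT (Fq : Type*) [Field Fq] [Fintype Fq] (n : ℕ) : Finset (Polynomial Fq) :=
  Finset.univ.image fun v : Fin n → Fq =>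
    (((Polynomial.degreeLTEquiv Fq n).symm v : Polynomial.degreeLT Fq n) : Polynomial Fq)

lemma mem_polysLT {n : ℕ} {b : Polynomial Fq} : b ∈ polysLT Fq n ↔ b.degree < n := by
  rw [← Polynomial.mem_degreeLT, polysLT, Finset.mem_image]
  constructor
  · rintro ⟨v, _, rfl⟩
    exact Subtype.mem _
  · intro h
    exact ⟨Polynomial.degreeLTEquiv Fq n ⟨b, h⟩, Finset.mem_univ _, by simp⟩

lemma zero_mem_polysLT (n : ℕ) : (0 : Polynomial Fq) ∈ polysLT Fq n :=
  mem_polysLT.2 (by simp)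

lemma mem_polysLT_erase_zero {n : ℕ} {b : Polynomial Fq} :
    b ∈ (polysLT Fq n).erase 0 ↔ b ≠ 0 ∧ b.natDegree < n := by
  rw [Finset.mem_erase, mem_polysLT]
  exact and_congr_right fun hb => (Polynomial.natDegree_lt_iff_degree_lt hb).symm

lemma card_polysLT (n : ℕ) : (polysLT Fq n).card = Fintype.card Fq ^ n := by
  have hinj : Function.Injective fun v : Fin n → Fq =>
      (((Polynomial.degreeLTEquiv Fq n).symm v : Polynomial.degreeLT Fq n) : Polynomial Fq) :=
    Subtype.val_injective.comp (LinearEquiv.injective _)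
  rw [polysLT, Finset.card_image_of_injective _ hinj, Finset.card_univ]
  simp

lemma sum_polysLT_sub_natDegree (n : ℕ) :
    ((Fintype.card Fq : ℝ) - 1) *
      ((n - 1) + ∑ b ∈ (polysLT Fq n).erase 0, ((n : ℝ) - 1 - b.natDegree)) =
      (Fintype.card Fq : ℝ) ^ n - Fintype.card Fq := by
  induction n with
  | zero =>
    have h : (polysLT Fq 0).erase 0 = ∅ :=
      Finset.eq_empty_of_forall_notMem fun b hb => by
        simpa using (mem_polysLT_erase_zero.1 hb).2
    simp [h]
  | succ n ih =>
    have hsub : (polysLT Fq n).erase 0 ⊆ (polysLT Fq (n + 1)).erase 0 := fun b hb => by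
      rw [mem_polysLT_erase_zero] at hb ⊢
      exact ⟨hb.1, hb.2.trans (Nat.lt_succ_self n)⟩
    rw [← Finset.sum_subset hsub]
    · have e : ∀ b ∈ (polysLT Fq n).erase 0, ((n + 1 : ℕ) : ℝ) - 1 - b.natDegree
          = ((n : ℝ) - 1 - b.natDegree) + 1 := fun b _ => by push_cast; ring
      have hcard : (((polysLT Fq n).erase 0).card : ℝ) = (Fintype.card Fq : ℝ) ^ n - 1 := by
        rw [Finset.card_erase_of_mem (zero_mem_polysLT n), card_polysLT,
          Nat.cast_sub (Nat.one_le_pow _ _ Fintype.card_pos)]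
        push_cast
        ring
      rw [Finset.sum_congr rfl e, Finset.sum_add_distrib, Finset.sum_const, nsmul_one, hcard]
      push_cast
      rw [pow_succ]
      linear_combination ih
    · intro b hb hb'
      rw [mem_polysLT_erase_zero] at hb hb'
      have : b.natDegree = n := by
        have hle : ¬ b.natDegree < n := fun h => hb' ⟨hb.1, h⟩
        omega
      rw [this]
      push_cast
      ring

lemma norm_algebraMap_le {q : ℕ} (hq1 : (1 : ℝ) < q)
    (hA : ∀ a : Polynomial Fq, a ≠ 0 → ‖algebraMap (Polynomial Fq) L a‖ = (q : ℝ) ^ a.natDegree)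
    {a : Polynomial Fq} {n : ℕ} (ha : a.natDegree ≤ n) :
    ‖algebraMap (Polynomial Fq) L a‖ ≤ (q : ℝ) ^ n := by
  by_cases h : a = 0
  · rw [h, map_zero, norm_zero]
    positivity
  · rw [hA a h]
    exact pow_le_pow_right₀ hq1.le ha

lemma norm_pair_of_norm_eq_sInf [IsUltrametricDist L] {ω : L}
    (hinj : Function.Injective (algebraMap (Polynomial Fq) L))
    (hωi : ‖ω‖ = sInf {y : ℝ | ∃ x ∈ Kinfty (Fq := Fq) (L := L), y = ‖ω - x‖})
    (a b : Polynomial Fq) :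
    ‖algebraMap (Polynomial Fq) L a * ω + algebraMap (Polynomial Fq) L b‖ =
      max (‖algebraMap (Polynomial Fq) L a‖ * ‖ω‖) ‖algebraMap (Polynomial Fq) L b‖ := by
  by_cases ha : a = 0
  · simp [ha]
  have ha' : algebraMap (Polynomial Fq) L a ≠ 0 := (map_ne_zero_iff _ hinj).2 ha
  rw [← norm_mul]
  by_cases hne : ‖algebraMap (Polynomial Fq) L a * ω‖ = ‖algebraMap (Polynomial Fq) L b‖
  · refine le_antisymm (IsUltrametricDist.norm_add_le_max _ _) ?_
    rw [← hne, max_self]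
    have hx : -algebraMap (Polynomial Fq) L b / algebraMap (Polynomial Fq) L a ∈
        Kinfty (Fq := Fq) (L := L) :=
      subset_closure (div_mem (neg_mem (Subfield.subset_closure ⟨b, rfl⟩))
        (Subfield.subset_closure ⟨a, rfl⟩))
    have hle : ‖ω‖ ≤ ‖ω - -algebraMap (Polynomial Fq) L b / algebraMap (Polynomial Fq) L a‖ := by
      conv_lhs => rw [hωi]
      refine csInf_le ⟨0, ?_⟩ ⟨_, hx, rfl⟩
      rintro _ ⟨x, _, rfl⟩
      exact norm_nonneg _
    have e : algebraMap (Polynomial Fq) L a * ω + algebraMap (Polynomial Fq) L b =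
        algebraMap (Polynomial Fq) L a *
          (ω - -algebraMap (Polynomial Fq) L b / algebraMap (Polynomial Fq) L a) := by
      field_simp
      ring
    rw [e, norm_mul, norm_mul]
    gcongr
  · exact IsUltrametricDist.norm_add_eq_max_of_norm_ne_norm hne

lemma mem_span_pair_one {ω x : L} :
    x ∈ Submodule.span (Polynomial Fq) {ω, (1 : L)} ↔
      ∃ a b : Polynomial Fq,
        algebraMap (Polynomial Fq) L a * ω + algebraMap (Polynomial Fq) L b = x := by
  simp [Submodule.mem_span_pair, Algebra.smul_def]

/-- The point `T⁻¹(c·ω + d)`. -/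
def torsionPt (ω : L) (c d : Fq) : L :=
  (algebraMap (Polynomial Fq) L Polynomial.X)⁻¹ *
    (algebraMap (Polynomial Fq) L (Polynomial.C c) * ω +
      algebraMap (Polynomial Fq) L (Polynomial.C d))

section

variable {q : ℕ} {ω : L} {ℓ : ℕ}

lemma finite_span_pair_one (hq1 : (1 : ℝ) < q)
    (hA : ∀ a : Polynomial Fq, a ≠ 0 → ‖algebraMap (Polynomial Fq) L a‖ = (q : ℝ) ^ a.natDegree)
    (hωl : ‖ω‖ = (q : ℝ) ^ ℓ)
    (hpair : ∀ a b : Polynomial Fq,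
      ‖algebraMap (Polynomial Fq) L a * ω + algebraMap (Polynomial Fq) L b‖ =
        max (‖algebraMap (Polynomial Fq) L a‖ * ‖ω‖) ‖algebraMap (Polynomial Fq) L b‖) (B : ℝ) :
    {x : L | x ∈ Submodule.span (Polynomial Fq) {ω, (1 : L)} ∧ ‖x‖ ≤ B}.Finite := by
  obtain ⟨n, hn⟩ := pow_unbounded_of_one_lt B hq1
  have key : ∀ a : Polynomial Fq, ‖algebraMap (Polynomial Fq) L a‖ ≤ B → a ∈ polysLT Fq n := by
    intro a ha
    by_cases h : a = 0
    · exact h ▸ zero_mem_polysLT n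
    · rw [hA a h] at ha
      rw [mem_polysLT, ← Polynomial.natDegree_lt_iff_degree_lt h]
      exact (pow_lt_pow_iff_right₀ hq1).1 (ha.trans_lt hn)
  refine ((polysLT Fq n ×ˢ polysLT Fq n).image fun p : Polynomial Fq × Polynomial Fq =>
    algebraMap (Polynomial Fq) L p.1 * ω + algebraMap (Polynomial Fq) L p.2).finite_toSet.subset ?_
  rintro x ⟨hx, hxB⟩
  obtain ⟨a, b, rfl⟩ := mem_span_pair_one.1 hx
  rw [hpair, max_le_iff] at hxB
  have h1 : (1 : ℝ) ≤ ‖ω‖ := hωl ▸ one_le_pow₀ hq1.le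
  refine Finset.mem_coe.2 (Finset.mem_image.2 ⟨(a, b), Finset.mem_product.2
    ⟨key a ((le_mul_of_one_le_right (norm_nonneg _) h1).trans hxB.1), key b hxB.2⟩, rfl⟩)

lemma linearIndependent_pair_one
    (hinj : Function.Injective (algebraMap (Polynomial Fq) L)) (hω : ω ≠ 0)
    (hpair : ∀ a b : Polynomial Fq,
      ‖algebraMap (Polynomial Fq) L a * ω + algebraMap (Polynomial Fq) L b‖ =
        max (‖algebraMap (Polynomial Fq) L a‖ * ‖ω‖) ‖algebraMap (Polynomial Fq) L b‖) :
    LinearIndependent (Polynomial Fq) ![ω, (1 : L)] := by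
  rw [LinearIndependent.pair_iff]
  intro a b hab
  rw [Algebra.smul_def, Algebra.smul_def, mul_one] at hab
  have h := hpair a b
  rw [hab, norm_zero] at h
  have ha : ‖algebraMap (Polynomial Fq) L a‖ * ‖ω‖ ≤ 0 := (le_max_left _ _).trans h.ge
  have hb : ‖algebraMap (Polynomial Fq) L b‖ ≤ 0 := (le_max_right _ _).trans h.ge
  rw [← norm_mul, norm_le_zero_iff, mul_eq_zero, or_iff_left hω, map_eq_zero_iff _ hinj] at ha
  rw [norm_le_zero_iff, map_eq_zero_iff _ hinj] at hb
  exact ⟨ha, hb⟩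

lemma norm_torsionPt
    (hA : ∀ a : Polynomial Fq, a ≠ 0 → ‖algebraMap (Polynomial Fq) L a‖ = (q : ℝ) ^ a.natDegree)
    (hpair : ∀ a b : Polynomial Fq,
      ‖algebraMap (Polynomial Fq) L a * ω + algebraMap (Polynomial Fq) L b‖ =
        max (‖algebraMap (Polynomial Fq) L a‖ * ‖ω‖) ‖algebraMap (Polynomial Fq) L b‖)
    (c d : Fq) :
    ‖torsionPt ω c d‖ = max (‖algebraMap (Polynomial Fq) L (Polynomial.C c)‖ * ‖ω‖)
      ‖algebraMap (Polynomial Fq) L (Polynomial.C d)‖ / q := by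
  rw [torsionPt, norm_mul, hpair, norm_inv, hA _ Polynomial.X_ne_zero, Polynomial.natDegree_X,
    pow_one, inv_mul_eq_div]

lemma norm_algebraMap_C
    (hA : ∀ a : Polynomial Fq, a ≠ 0 → ‖algebraMap (Polynomial Fq) L a‖ = (q : ℝ) ^ a.natDegree)
    {c : Fq} (hc : c ≠ 0) : ‖algebraMap (Polynomial Fq) L (Polynomial.C c)‖ = 1 := by
  rw [hA _ (Polynomial.C_ne_zero.2 hc), Polynomial.natDegree_C, pow_zero]

lemma norm_latExp_torsionPt_zero [IsUltrametricDist L] (hq1 : (1 : ℝ) < q)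
    (hA : ∀ a : Polynomial Fq, a ≠ 0 → ‖algebraMap (Polynomial Fq) L a‖ = (q : ℝ) ^ a.natDegree)
    (hωl : ‖ω‖ = (q : ℝ) ^ ℓ)
    (hpair : ∀ a b : Polynomial Fq,
      ‖algebraMap (Polynomial Fq) L a * ω + algebraMap (Polynomial Fq) L b‖ =
        max (‖algebraMap (Polynomial Fq) L a‖ * ‖ω‖) ‖algebraMap (Polynomial Fq) L b‖)
    {d : Fq} (hd : d ≠ 0) :
    ‖latExp (Submodule.span (Polynomial Fq) {ω, (1 : L)}) (torsionPt ω 0 d)‖ = (q : ℝ)⁻¹ := by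
  have hw : ‖torsionPt ω 0 d‖ = (q : ℝ)⁻¹ := by
    rw [norm_torsionPt hA hpair, norm_algebraMap_C hA hd]
    simp
  rw [norm_latExp _ (finite_span_pair_one hq1 hA hωl hpair) _ ∅ (by simp), Finset.prod_empty,
    mul_one, hw]
  intro x hx hx0 _
  refine lt_of_lt_of_le (hw.trans_lt (inv_lt_one_of_one_lt₀ hq1)) ?_
  obtain ⟨a, b, rfl⟩ := mem_span_pair_one.1 hx
  rw [hpair]
  by_cases ha : a = 0
  · have hb : b ≠ 0 := by
      rintro rfl
      simp [ha] at hx0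
    exact le_max_of_le_right (hA b hb ▸ one_le_pow₀ hq1.le)
  · refine le_max_of_le_left ?_
    rw [hA a ha, hωl]
    exact one_le_mul_of_one_le_of_one_le (one_le_pow₀ hq1.le) (one_le_pow₀ hq1.le)

lemma norm_latExp_torsionPt [IsUltrametricDist L] (hq1 : (1 : ℝ) < q)
    (hinj : Function.Injective (algebraMap (Polynomial Fq) L))
    (hA : ∀ a : Polynomial Fq, a ≠ 0 → ‖algebraMap (Polynomial Fq) L a‖ = (q : ℝ) ^ a.natDegree)
    (hωl : ‖ω‖ = (q : ℝ) ^ ℓ)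
    (hpair : ∀ a b : Polynomial Fq,
      ‖algebraMap (Polynomial Fq) L a * ω + algebraMap (Polynomial Fq) L b‖ =
        max (‖algebraMap (Polynomial Fq) L a‖ * ‖ω‖) ‖algebraMap (Polynomial Fq) L b‖)
    {c : Fq} (hc : c ≠ 0) (d : Fq) :
    ‖latExp (Submodule.span (Polynomial Fq) {ω, (1 : L)}) (torsionPt ω c d)‖ =
      (q : ℝ) ^ ℓ / q * ∏ b ∈ (polysLT Fq ℓ).erase 0, (q : ℝ) ^ ℓ / q / (q : ℝ) ^ b.natDegree := by
  have hq0 : (0 : ℝ) < q := zero_lt_one.trans hq1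
  have hw : ‖torsionPt ω c d‖ = (q : ℝ) ^ ℓ / q := by
    rw [norm_torsionPt hA hpair, norm_algebraMap_C hA hc, one_mul, hωl, max_eq_left]
    exact norm_algebraMap_le hq1 hA (by simp)
  rw [norm_latExp _ (finite_span_pair_one hq1 hA hωl hpair) _
    (((polysLT Fq ℓ).erase 0).image (algebraMap (Polynomial Fq) L)), hw,
    Finset.prod_image hinj.injOn]
  · congr 1
    refine Finset.prod_congr rfl fun b hb => ?_
    rw [mem_polysLT_erase_zero] at hb
    have hX : algebraMap (Polynomial Fq) L Polynomial.X ≠ 0 :=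
      (map_ne_zero_iff _ hinj).2 Polynomial.X_ne_zero
    have hb' : algebraMap (Polynomial Fq) L b ≠ 0 := (map_ne_zero_iff _ hinj).2 hb.1
    have e : 1 - torsionPt ω c d / algebraMap (Polynomial Fq) L b =
        (algebraMap (Polynomial Fq) L (Polynomial.C (-c)) * ω +
          algebraMap (Polynomial Fq) L (Polynomial.X * b - Polynomial.C d)) /
          algebraMap (Polynomial Fq) L Polynomial.X / algebraMap (Polynomial Fq) L b := by
      rw [torsionPt]
      simp only [map_neg, map_sub, map_mul]
      field_simp
      ring
    rw [e, norm_div, norm_div, hpair, norm_algebraMap_C hA (neg_ne_zero.2 hc), one_mul, hωl,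
      hA _ Polynomial.X_ne_zero, hA b hb.1, Polynomial.natDegree_X, pow_one, max_eq_left]
    refine norm_algebraMap_le hq1 hA ?_
    rw [Polynomial.natDegree_sub_C]
    refine Polynomial.natDegree_mul_le.trans ?_
    rw [Polynomial.natDegree_X]
    omega
  · intro x hx
    obtain ⟨b, hb, rfl⟩ := Finset.mem_image.1 hx
    exact ⟨mem_span_pair_one.2 ⟨0, b, by simp⟩,
      (map_ne_zero_iff _ hinj).2 (mem_polysLT_erase_zero.1 hb).1⟩
  · intro x hx hx0 hxs
    rw [hw]
    refine lt_of_lt_of_le (div_lt_self (by positivity) hq1) ?_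
    obtain ⟨a, b, rfl⟩ := mem_span_pair_one.1 hx
    rw [hpair]
    by_cases ha : a = 0
    · subst ha
      have hb : b ≠ 0 := by
        rintro rfl
        simp at hx0
      refine le_max_of_le_right ?_
      rw [hA b hb]
      refine pow_le_pow_right₀ hq1.le ?_
      by_contra hcon
      exact hxs (Finset.mem_image.2 ⟨b, mem_polysLT_erase_zero.2 ⟨hb, not_le.1 hcon⟩, by simp⟩)
    · refine le_max_of_le_left ?_
      rw [hA a ha, hωl]
      exact le_mul_of_one_le_left (by positivity) (one_le_pow₀ hq1.le)

lemma logb_norm_latExp_torsionPt [IsUltrametricDist L] (hq : Fintype.card Fq = q)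
    (hq1 : (1 : ℝ) < q)
    (hinj : Function.Injective (algebraMap (Polynomial Fq) L))
    (hA : ∀ a : Polynomial Fq, a ≠ 0 → ‖algebraMap (Polynomial Fq) L a‖ = (q : ℝ) ^ a.natDegree)
    (hωl : ‖ω‖ = (q : ℝ) ^ ℓ)
    (hpair : ∀ a b : Polynomial Fq,
      ‖algebraMap (Polynomial Fq) L a * ω + algebraMap (Polynomial Fq) L b‖ =
        max (‖algebraMap (Polynomial Fq) L a‖ * ‖ω‖) ‖algebraMap (Polynomial Fq) L b‖)
    {c : Fq} (hc : c ≠ 0) (d : Fq) :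
    Real.logb q ‖latExp (Submodule.span (Polynomial Fq) {ω, (1 : L)}) (torsionPt ω c d)‖ =
      ((q : ℝ) ^ ℓ - q) / (q - 1) := by
  have hq0 : (q : ℝ) ≠ 0 := by positivity
  have hlog : ∀ k : ℕ, Real.logb q ((q : ℝ) ^ k) = k := fun k => by
    rw [Real.logb_pow, Real.logb_self_eq_one hq1, mul_one]
  have h1 : Real.logb q ((q : ℝ) ^ ℓ / q) = ℓ - 1 := by
    rw [Real.logb_div (by positivity) hq0, hlog, Real.logb_self_eq_one hq1]
  rw [norm_latExp_torsionPt hq1 hinj hA hωl hpair hc, Real.logb_mul (by positivity)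
    (by positivity), Real.logb_prod _ _ fun b _ => by positivity, h1, eq_div_iff (by linarith),
    mul_comm, ← hq, ← sum_polysLT_sub_natDegree, hq]
  congr 2
  refine Finset.sum_congr rfl fun b _ => ?_
  rw [Real.logb_div (by positivity) (by positivity), h1, hlog]

end

lemma prod_erase_zero_eq_of_isRepSet {Λ Λ' : Submodule (Polynomial Fq) L} {R : Finset L}
    (hR : IsRepSet Λ Λ' R) (hR0 : (0 : L) ∈ R) {α : Type*} [Fintype α] [DecidableEq α] (t : α → L) (z : α)
    (htz : t z = 0) (ht : ∀ p, t p ∈ Λ') (htinj : ∀ p p', t p - t p' ∈ Λ → p = p')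
    (htsurj : ∀ y ∈ Λ', ∃ p, y - t p ∈ Λ) (F : L → ℝ)
    (hF : ∀ w w', w - w' ∈ Λ → F w = F w') :
    ∏ w ∈ R.erase 0, F w = ∏ p ∈ Finset.univ.erase z, F (t p) := by
  choose r hr hr' using fun p => hR.2 (t p) (ht p)
  have hr_eq : ∀ p w, w ∈ R → t p - w ∈ Λ → w = r p := fun p w hw h => hr' p w ⟨hw, h⟩
  have hrz : r z = 0 := (hr_eq z 0 hR0 (by simp [htz])).symm
  have hrinj : ∀ p p', r p = r p' → p = p' := fun p p' h => htinj p p' <| by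
    have := Λ.sub_mem (hr p).2 (hr p').2
    rwa [h, sub_sub_sub_cancel_right] at this
  symm
  refine Finset.prod_bij (fun p _ => r p) ?_ (fun p _ p' _ h => hrinj p p' h) ?_
    fun p _ => hF _ _ (hr p).2
  · intro p hp
    exact Finset.mem_erase.2 ⟨fun h => (Finset.mem_erase.1 hp).1 (hrinj p z (h.trans hrz.symm)),
      (hr p).1⟩
  · intro w hw
    rw [Finset.mem_erase] at hw
    obtain ⟨p, hp⟩ := htsurj w (hR.1 w hw.2)
    have hwp : w = r p := hr_eq p w hw.2 (by simpa using Λ.neg_mem hp)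
    refine ⟨p, Finset.mem_erase.2 ⟨?_, Finset.mem_univ _⟩, hwp.symm⟩
    rintro rfl
    exact hw.1 (hwp.trans hrz)

lemma isRepSet_image {Λ Λ' : Submodule (Polynomial Fq) L} {α : Type*} [Fintype α] (t : α → L)
    (ht : ∀ p, t p ∈ Λ') (htinj : ∀ p p', t p - t p' ∈ Λ → p = p')
    (htsurj : ∀ y ∈ Λ', ∃ p, y - t p ∈ Λ) : IsRepSet Λ Λ' (Finset.univ.image t) := by
  refine ⟨fun w hw => ?_, fun y hy => ?_⟩
  · obtain ⟨p, _, rfl⟩ := Finset.mem_image.1 hw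
    exact ht p
  · obtain ⟨p, hp⟩ := htsurj y hy
    refine ⟨t p, ⟨Finset.mem_image_of_mem t (Finset.mem_univ p), hp⟩, ?_⟩
    rintro w ⟨hw, hyw⟩
    obtain ⟨p', _, rfl⟩ := Finset.mem_image.1 hw
    have := Λ.sub_mem hp hyw
    rw [sub_sub_sub_cancel_left] at this
    rw [htinj p' p this]

lemma mem_scaleSub_span_pair_one {c ω x : L} :
    x ∈ scaleSub c (Submodule.span (Polynomial Fq) {ω, (1 : L)}) ↔
      ∃ a b : Polynomial Fq,
        c * (algebraMap (Polynomial Fq) L a * ω + algebraMap (Polynomial Fq) L b) = x := by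
  rw [scaleSub, Submodule.mem_map]
  simp only [mem_span_pair_one, LinearMap.mulLeft_apply]
  constructor
  · rintro ⟨_, ⟨a, b, rfl⟩, rfl⟩
    exact ⟨a, b, rfl⟩
  · rintro ⟨a, b, rfl⟩
    exact ⟨_, ⟨a, b, rfl⟩, rfl⟩

lemma eq_of_torsionPt_sub_mem {ω : L}
    (hX : algebraMap (Polynomial Fq) L Polynomial.X ≠ 0)
    (hli : LinearIndependent (Polynomial Fq) ![ω, (1 : L)]) {c d c' d' : Fq}
    (h : torsionPt ω c d - torsionPt ω c' d' ∈ Submodule.span (Polynomial Fq) {ω, (1 : L)}) :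
    c = c' ∧ d = d' := by
  obtain ⟨a, b, hab⟩ := mem_span_pair_one.1 h
  have h0 := LinearIndependent.pair_iff.1 hli
    (Polynomial.C c - Polynomial.C c' - Polynomial.X * a)
    (Polynomial.C d - Polynomial.C d' - Polynomial.X * b) <| by
      rw [torsionPt, torsionPt, ← mul_sub, eq_inv_mul_iff_mul_eq₀ hX] at hab
      simp only [Algebra.smul_def, map_sub, map_mul]
      linear_combination -hab
  have hc := congrArg (fun p => Polynomial.coeff p 0) h0.1
  have hd := congrArg (fun p => Polynomial.coeff p 0) h0.2
  simp only [Polynomial.coeff_sub, Polynomial.coeff_C_zero, Polynomial.coeff_X_mul_zero,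
    Polynomial.coeff_zero, sub_zero] at hc hd
  exact ⟨sub_eq_zero.1 hc, sub_eq_zero.1 hd⟩

lemma exists_sub_torsionPt_mem {ω : L}
    (hX : algebraMap (Polynomial Fq) L Polynomial.X ≠ 0) {y : L}
    (hy : y ∈ scaleSub (algebraMap (Polynomial Fq) L Polynomial.X)⁻¹
      (Submodule.span (Polynomial Fq) {ω, (1 : L)})) :
    ∃ p : Fq × Fq,
      y - torsionPt ω p.1 p.2 ∈ Submodule.span (Polynomial Fq) {ω, (1 : L)} := by
  obtain ⟨a, b, rfl⟩ := mem_scaleSub_span_pair_one.1 hy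
  refine ⟨(a.coeff 0, b.coeff 0), mem_span_pair_one.2 ⟨a.divX, b.divX, ?_⟩⟩
  have ha := congrArg (algebraMap (Polynomial Fq) L) a.divX_mul_X_add
  have hb := congrArg (algebraMap (Polynomial Fq) L) b.divX_mul_X_add
  rw [map_add, map_mul] at ha hb
  rw [torsionPt, ← mul_sub, eq_inv_mul_iff_mul_eq₀ hX]
  linear_combination ω * ha + hb

lemma sum_erase_zero_ite (x y : ℝ) :
    ∑ p ∈ (Finset.univ : Finset (Fq × Fq)).erase 0, (if p.1 = 0 then x else y) =
      (Fintype.card Fq - 1) * x + Fintype.card Fq * (Fintype.card Fq - 1) * y := by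
  have h1 : ∀ c : Fq, (if c = 0 then x else y) = y + if c = 0 then x - y else 0 := fun c => by
    split_ifs <;> ring
  rw [Finset.sum_erase_eq_sub (Finset.mem_univ _), Fintype.sum_prod_type]
  simp only [Finset.sum_const, Finset.card_univ, nsmul_eq_mul, Prod.fst_zero, if_true, h1,
    mul_add, Finset.sum_add_distrib, ← Finset.mul_sum, Finset.sum_ite_eq', Finset.mem_univ]
  ring

/-- For `ω` in the fundamental domain with `|ω| = |ω|_i = q^ℓ`
(`ℓ ∈ ℕ₀`), `Λ = A·ω + A` is a lattice of rank `2` and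
`log Δ_T(Λ) = q² + q - q^{ℓ+1}`, where `Δ_T(Λ) = T·(∏_{0≠w∈(T⁻¹Λ)/Λ} e^Λ(w))⁻¹`. -/
theorem statement18
    (q : ℕ) (hq : Fintype.card Fq = q)
    (hna : ∀ x y : L, ‖x + y‖ ≤ max ‖x‖ ‖y‖)
    (hA : ∀ a : Polynomial Fq, a ≠ 0 →
      ‖algebraMap (Polynomial Fq) L a‖ = (q : ℝ) ^ a.natDegree)
    (hval : ∀ x : L, x ≠ 0 → ∃ s : ℚ, ‖x‖ = (q : ℝ) ^ (s : ℝ))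
    (ω : L) (ℓ : ℕ)
    (hωi : ‖ω‖ = sInf {y : ℝ | ∃ x ∈ Kinfty (Fq := Fq) (L := L), y = ‖ω - x‖})
    (hωl : ‖ω‖ = (q : ℝ) ^ ℓ) :
    IsLatticeOfRank 2 (Submodule.span (Polynomial Fq) {ω, (1 : L)}) ∧
    logq q (algebraMap (Polynomial Fq) L Polynomial.X *
        latDisc (Submodule.span (Polynomial Fq) {ω, (1 : L)})
          (scaleSub (algebraMap (Polynomial Fq) L Polynomial.X)⁻¹
            (Submodule.span (Polynomial Fq) {ω, (1 : L)}))) =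
      (q : ℝ) ^ 2 + (q : ℝ) - (q : ℝ) ^ (ℓ + 1) := by
  have : IsUltrametricDist L :=
    IsUltrametricDist.isUltrametricDist_of_forall_norm_add_le_max_norm hna
  have hq1 : (1 : ℝ) < q := by
    rw [← hq]
    exact_mod_cast Fintype.one_lt_card
  have hq0 : (0 : ℝ) < q := zero_lt_one.trans hq1
  have hinj : Function.Injective (algebraMap (Polynomial Fq) L) := by
    rw [injective_iff_map_eq_zero]
    intro a ha
    by_contra h
    have h' := hA a h
    rw [ha, norm_zero] at h'
    exact (pow_pos hq0 _).ne h'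
  have hX : algebraMap (Polynomial Fq) L Polynomial.X ≠ 0 :=
    (map_ne_zero_iff _ hinj).2 Polynomial.X_ne_zero
  have hω : ω ≠ 0 := norm_pos_iff.1 (hωl ▸ pow_pos hq0 ℓ)
  have hpair := norm_pair_of_norm_eq_sInf hinj hωi
  have hli := linearIndependent_pair_one hinj hω hpair
  have hfin := finite_span_pair_one hq1 hA hωl hpair
  refine ⟨⟨⟨![ω, 1], hli, by rw [Matrix.range_cons_cons_empty]⟩, hfin⟩, ?_⟩
  set Λ := Submodule.span (Polynomial Fq) {ω, (1 : L)}
  set Λ' := scaleSub (algebraMap (Polynomial Fq) L Polynomial.X)⁻¹ Λ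
  set t : Fq × Fq → L := fun p => torsionPt ω p.1 p.2 with ht_def
  have ht0 : t 0 = 0 := by simp [ht_def, torsionPt]
  have ht : ∀ p, t p ∈ Λ' := fun p => mem_scaleSub_span_pair_one.2 ⟨_, _, rfl⟩
  have htinj : ∀ p p', t p - t p' ∈ Λ → p = p' := fun p p' h =>
    Prod.ext_iff.2 (eq_of_torsionPt_sub_mem hX hli h)
  have htsurj : ∀ y ∈ Λ', ∃ p, y - t p ∈ Λ := fun y hy => exists_sub_torsionPt_mem hX hy
  have hex : ∃ R : Finset L, IsRepSet Λ Λ' R ∧ (0 : L) ∈ R :=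
    ⟨_, isRepSet_image t ht htinj htsurj, ht0 ▸ Finset.mem_image_of_mem t (Finset.mem_univ 0)⟩
  have hlog : ∀ p ∈ (Finset.univ : Finset (Fq × Fq)).erase 0, Real.logb q ‖latExp Λ (t p)‖ =
      if p.1 = 0 then -1 else ((q : ℝ) ^ ℓ - q) / (q - 1) := by
    rintro ⟨c, d⟩ hp
    split_ifs with hc
    · obtain rfl : c = 0 := hc
      have hd : d ≠ 0 := by
        rintro rfl
        exact (Finset.mem_erase.1 hp).1 rfl
      rw [norm_latExp_torsionPt_zero hq1 hA hωl hpair hd, Real.logb_inv,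
        Real.logb_self_eq_one hq1]
    · exact logb_norm_latExp_torsionPt hq hq1 hinj hA hωl hpair hc d
  have hne : ∀ p ∈ (Finset.univ : Finset (Fq × Fq)).erase 0, ‖latExp Λ (t p)‖ ≠ 0 := by
    rintro ⟨c, d⟩ hp
    by_cases hc : c = 0
    · have hd : d ≠ 0 := by
        rintro rfl
        exact (Finset.mem_erase.1 hp).1 (by rw [hc]; rfl)
      subst hc
      rw [norm_latExp_torsionPt_zero hq1 hA hωl hpair hd]
      positivity
    · rw [norm_latExp_torsionPt hq1 hinj hA hωl hpair hc]
      positivity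
  rw [logq, latDisc, dif_pos hex, norm_mul, norm_inv, norm_prod,
    prod_erase_zero_eq_of_isRepSet hex.choose_spec.1 hex.choose_spec.2 t 0 ht0 ht htinj htsurj
      (fun w => ‖latExp Λ w‖) (fun w w' h => norm_latExp_congr Λ hfin h),
    hA _ Polynomial.X_ne_zero, Polynomial.natDegree_X, pow_one,
    Real.logb_mul hq0.ne' (inv_ne_zero (Finset.prod_ne_zero_iff.2 hne)), Real.logb_inv,
    Real.logb_self_eq_one hq1, Real.logb_prod _ _ hne, Finset.sum_congr rfl hlog,
    sum_erase_zero_ite, hq]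
  have hq1' : (q : ℝ) - 1 ≠ 0 := by linarith
  field_simp
  ring
end
end
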